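/- arXiv:2509.26338 — 2 statements merged into one kernel-verified Lean document; each statement's English description precedes it below -/
import Mathlib

section
/- (Wolff's theorem) Given any bounded measurable function f on the unit circle ∂𝔻, there exists an outer function E belonging to QA such that the product Ef of the boundary values of E with f belongs to VMO. -/
open MeasureTheory Filter Set Topology

noncomputable section

/-- The open unit disc in `ℂ`. -/
def unitDisc : Set ℂ := {z : ℂ | ‖z‖ < 1}

/-- The point `e^{iθ}` on the unit circle. -/
def circlePt (θ : ℝ) : ℂ := Complex.exp ((θ : ℂ) * Complex.I)

/-- The Carleson square based on the arc centered at `e^{iθ₀}` of normalized length `t`. -/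
def carlesonSquare (θ₀ t : ℝ) : Set ℂ :=
  {z : ℂ | z ∈ unitDisc ∧ 1 - t ≤ ‖z‖ ∧
    ∃ θ : ℝ, |θ - θ₀| ≤ Real.pi * t ∧ z = (‖z‖ : ℂ) * circlePt θ}

/-- `μ` is a Carleson measure. -/
def IsCarleson (μ : Measure ℂ) : Prop :=
  ∃ C : ℝ, 0 < C ∧ ∀ θ₀ t : ℝ, 0 < t → t ≤ 1 →
    μ (carlesonSquare θ₀ t) ≤ ENNReal.ofReal (C * t)

/-- `μ` is a vanishing Carleson measure. -/
def IsVanishingCarleson (μ : Measure ℂ) : Prop :=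
  IsCarleson μ ∧ ∀ ε : ℝ, 0 < ε → ∃ δ : ℝ, 0 < δ ∧ ∀ θ₀ t : ℝ, 0 < t → t < δ →
    μ (carlesonSquare θ₀ t) ≤ ENNReal.ofReal (ε * t)

/-- The measure `|E| μ`, i.e. `d(|E|μ)(z) = |E(z)| dμ(z)`. -/
def absDensity (E : ℂ → ℂ) (μ : Measure ℂ) : Measure ℂ :=
  μ.withDensity (fun z => ENNReal.ofReal ‖E z‖)

/-- Average of a boundary function (in the angle variable) over the arc
centered at `e^{iθ₀}` of normalized length `t`; `dm = dθ/(2π)`. -/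
def arcAvg (f : ℝ → ℂ) (θ₀ t : ℝ) : ℂ :=
  ((2 * Real.pi * t)⁻¹ : ℝ) •
    ∫ θ in Set.Ioo (θ₀ - Real.pi * t) (θ₀ + Real.pi * t), f θ

/-- Mean oscillation of a boundary function over the arc centered at `e^{iθ₀}`
of normalized length `t`. -/
def meanOsc (f : ℝ → ℂ) (θ₀ t : ℝ) : ℝ :=
  (2 * Real.pi * t)⁻¹ *
    ∫ θ in Set.Ioo (θ₀ - Real.pi * t) (θ₀ + Real.pi * t), ‖f θ - arcAvg f θ₀ t‖

/-- A (2π-periodic, integrable) boundary function has bounded mean oscillation. -/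
def IsBMO (f : ℝ → ℂ) : Prop :=
  (∀ θ : ℝ, f (θ + 2 * Real.pi) = f θ) ∧
  IntegrableOn f (Set.Ioc 0 (2 * Real.pi)) ∧
  ∃ C : ℝ, ∀ θ₀ t : ℝ, 0 < t → t ≤ 1 → meanOsc f θ₀ t ≤ C

/-- A boundary function has vanishing mean oscillation. -/
def IsVMO (f : ℝ → ℂ) : Prop :=
  IsBMO f ∧ ∀ ε : ℝ, 0 < ε → ∃ δ : ℝ, 0 < δ ∧
    ∀ θ₀ t : ℝ, 0 < t → t < δ → meanOsc f θ₀ t ≤ ε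

/-- The BMO seminorm of a boundary function. -/
def bmoSeminorm (f : ℝ → ℂ) : ℝ :=
  sSup {c : ℝ | ∃ θ₀ t : ℝ, 0 < t ∧ t ≤ 1 ∧ c = meanOsc f θ₀ t}

/-- `Fb` is the (a.e.) radial boundary function of `F`. -/
def HasRadialLimits (F : ℂ → ℂ) (Fb : ℝ → ℂ) : Prop :=
  ∀ᵐ θ ∂(volume.restrict (Set.Ioc 0 (2 * Real.pi))),
    Tendsto (fun r : ℝ => F ((r : ℂ) * circlePt θ))
      (nhdsWithin 1 (Set.Iio 1)) (nhds (Fb θ))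

/-- `F` is a bounded analytic function on the unit disc. -/
def MemHinf (F : ℂ → ℂ) : Prop :=
  DifferentiableOn ℂ F unitDisc ∧ ∃ M : ℝ, ∀ z ∈ unitDisc, ‖F z‖ ≤ M

/-- `F` belongs to `QA` with boundary function `Fb`: it is a bounded analytic
function on the disc whose radial boundary values are in VMO. -/
def MemQA (F : ℂ → ℂ) (Fb : ℝ → ℂ) : Prop :=
  MemHinf F ∧ HasRadialLimits F Fb ∧ IsVMO Fb

/-- `E` is an outer function. -/
def IsOuter (E : ℂ → ℂ) : Prop :=
  DifferentiableOn ℂ E unitDisc ∧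
  ∃ h : ℝ → ℝ, IntegrableOn h (Set.Ioc 0 (2 * Real.pi)) ∧ ∀ z ∈ unitDisc,
    E z = Complex.exp (((2 * Real.pi)⁻¹ : ℝ) • ∫ θ in Set.Ioc 0 (2 * Real.pi),
      ((circlePt θ + z) / (circlePt θ - z)) * (h θ : ℂ))

/-- The integral means appearing in the definition of the Hardy space `ℍ^p`. -/
def hardyIntegral (p : ℝ) (F : ℂ → ℂ) (r : ℝ) : ℝ :=
  ∫ θ in Set.Ioc 0 (2 * Real.pi), ‖F ((r : ℂ) * circlePt θ)‖ ^ p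

/-- `F` belongs to the Hardy space `ℍ^p`, `0 < p < ∞`. -/
def MemHardy (p : ℝ) (F : ℂ → ℂ) : Prop :=
  DifferentiableOn ℂ F unitDisc ∧
  ∃ M : ℝ, ∀ r : ℝ, 0 < r → r < 1 → hardyIntegral p F r ≤ M

/-- `F` belongs to `BMOA` with boundary function `Fb`. -/
def MemBMOA (F : ℂ → ℂ) (Fb : ℝ → ℂ) : Prop :=
  MemHardy 2 F ∧ HasRadialLimits F Fb ∧ IsBMO Fb

/-- `F` belongs to `VMOA` with boundary function `Fb`. -/
def MemVMOA (F : ℂ → ℂ) (Fb : ℝ → ℂ) : Prop :=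
  MemHardy 2 F ∧ HasRadialLimits F Fb ∧ IsVMO Fb

/-- The generalized Volterra operator `T_G(F)(z) = ∫₀^z F(w) G'(w) dw`. -/
def volterra (G F : ℂ → ℂ) (z : ℂ) : ℂ :=
  ∫ t in (0:ℝ)..1, z * F ((t : ℂ) * z) * deriv G ((t : ℂ) * z)

/-- Average of a real function of the angle over the arc centered at `e^{iθ₀}` of normalized
length `t`. -/
def arcMean (u : ℝ → ℝ) (θ₀ t : ℝ) : ℝ :=
  (2 * Real.pi * t)⁻¹ * ∫ θ in Set.Ioo (θ₀ - Real.pi * t) (θ₀ + Real.pi * t), u θ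

lemma circlePt_eq_circleMap (θ : ℝ) : circlePt θ = circleMap 0 1 θ := by
  simp [circlePt, circleMap]

lemma norm_circlePt (θ : ℝ) : ‖circlePt θ‖ = 1 := by
  simp [circlePt, Complex.norm_exp_ofReal_mul_I]

lemma continuous_circlePt : Continuous circlePt := by
  unfold circlePt; fun_prop

lemma circlePt_add_two_pi (θ : ℝ) : circlePt (θ + 2 * Real.pi) = circlePt θ := by
  rw [circlePt_eq_circleMap, circlePt_eq_circleMap, periodic_circleMap]

lemma arcMean_const (c θ₀ : ℝ) {t : ℝ} (ht : 0 < t) : arcMean (fun _ => c) θ₀ t = c := by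
  have : 0 < 2 * Real.pi * t := by positivity
  have h2 : θ₀ + Real.pi * t - (θ₀ - Real.pi * t) = 2 * Real.pi * t := by ring
  simp only [arcMean, setIntegral_const, Measure.real, Real.volume_Ioo, h2,
    ENNReal.toReal_ofReal this.le, smul_eq_mul]
  field_simp

lemma arcMean_mono {u v : ℝ → ℝ} {θ₀ t : ℝ} (ht : 0 < t)
    (hu : IntegrableOn u (Ioo (θ₀ - Real.pi * t) (θ₀ + Real.pi * t)))
    (hv : IntegrableOn v (Ioo (θ₀ - Real.pi * t) (θ₀ + Real.pi * t)))
    (huv : ∀ θ ∈ Ioo (θ₀ - Real.pi * t) (θ₀ + Real.pi * t), u θ ≤ v θ) :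
    arcMean u θ₀ t ≤ arcMean v θ₀ t := by
  unfold arcMean
  exact mul_le_mul_of_nonneg_left (setIntegral_mono_on hu hv measurableSet_Ioo huv)
    (by positivity)

lemma arcMean_add {u v : ℝ → ℝ} {θ₀ t : ℝ}
    (hu : IntegrableOn u (Ioo (θ₀ - Real.pi * t) (θ₀ + Real.pi * t)))
    (hv : IntegrableOn v (Ioo (θ₀ - Real.pi * t) (θ₀ + Real.pi * t))) :
    arcMean (fun θ => u θ + v θ) θ₀ t = arcMean u θ₀ t + arcMean v θ₀ t := by
  unfold arcMean
  rw [integral_add hu hv, mul_add]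

lemma arcMean_const_mul (c : ℝ) (u : ℝ → ℝ) (θ₀ t : ℝ) :
    arcMean (fun θ => c * u θ) θ₀ t = c * arcMean u θ₀ t := by
  unfold arcMean
  rw [integral_const_mul]; ring

lemma integrableOn_const_arc {E : Type*} [NormedAddCommGroup E] (c : E) (θ₀ t : ℝ) :
    IntegrableOn (fun _ => c) (Ioo (θ₀ - Real.pi * t) (θ₀ + Real.pi * t)) :=
  integrableOn_const (by simp)

/-- The mean oscillation is at most twice the mean distance to any constant. -/
lemma meanOsc_le_two_mul {f : ℝ → ℂ} {θ₀ t : ℝ} (c : ℂ) (ht : 0 < t)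
    (hf : IntegrableOn f (Ioo (θ₀ - Real.pi * t) (θ₀ + Real.pi * t))) :
    meanOsc f θ₀ t ≤ 2 * arcMean (fun θ => ‖f θ - c‖) θ₀ t := by
  have hfc : IntegrableOn (fun θ => f θ - c) (Ioo (θ₀ - Real.pi * t) (θ₀ + Real.pi * t)) :=
    hf.sub (integrableOn_const_arc c θ₀ t)
  have hfa : IntegrableOn (fun θ => f θ - arcAvg f θ₀ t)
      (Ioo (θ₀ - Real.pi * t) (θ₀ + Real.pi * t)) :=
    hf.sub (integrableOn_const_arc _ θ₀ t)
  have hp : 0 < 2 * Real.pi * t := by positivity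
  have h2 : θ₀ + Real.pi * t - (θ₀ - Real.pi * t) = 2 * Real.pi * t := by ring
  have hav : ‖c - arcAvg f θ₀ t‖ ≤ arcMean (fun θ => ‖f θ - c‖) θ₀ t := by
    have : arcAvg f θ₀ t - c = ((2 * Real.pi * t)⁻¹ : ℝ) •
        ∫ θ in Set.Ioo (θ₀ - Real.pi * t) (θ₀ + Real.pi * t), (f θ - c) := by
      rw [integral_sub hf (integrableOn_const_arc c θ₀ t), smul_sub, arcAvg, setIntegral_const,
        Measure.real, Real.volume_Ioo, h2, ENNReal.toReal_ofReal hp.le, smul_smul,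
        inv_mul_cancel₀ hp.ne', one_smul]
    rw [norm_sub_rev, this, norm_smul, Real.norm_of_nonneg (by positivity)]
    unfold arcMean
    gcongr
    exact norm_integral_le_integral_norm _
  have h1 : meanOsc f θ₀ t ≤
      arcMean (fun θ => ‖f θ - c‖ + ‖c - arcAvg f θ₀ t‖) θ₀ t := by
    refine arcMean_mono ht hfa.norm (hfc.norm.add (integrableOn_const_arc _ θ₀ t)) fun θ _ => ?_
    exact norm_sub_le_norm_sub_add_norm_sub _ _ _
  rw [arcMean_add hfc.norm (integrableOn_const_arc _ θ₀ t), arcMean_const _ _ ht] at h1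
  linarith

lemma integrableOn_of_bound {E : Type*} [NormedAddCommGroup E] {f : ℝ → E} {B : ℝ} {s : Set ℝ}
    (hf : AEStronglyMeasurable f) (hB : ∀ θ, ‖f θ‖ ≤ B) (hs : volume s ≠ ⊤) :
    IntegrableOn f s :=
  Measure.integrableOn_of_bounded hs hf (ae_of_all _ hB)

lemma volume_arc_ne_top (a b : ℝ) : volume (Ioo a b) ≠ ⊤ := by simp

/-- A function which is a bounded pointwise a.e. limit of functions whose mean oscillation is
eventually small on each small arc has vanishing mean oscillation. -/
lemma isVMO_of_tendsto {F : ℕ → ℝ → ℂ} {G : ℝ → ℂ} {B : ℝ}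
    (hF : ∀ n, AEStronglyMeasurable (F n)) (hB : ∀ n θ, ‖F n θ‖ ≤ B)
    (hG : ∀ᵐ θ, Tendsto (fun n => F n θ) atTop (𝓝 (G θ)))
    (hper : ∀ θ : ℝ, G (θ + 2 * Real.pi) = G θ)
    (hosc : ∀ ε : ℝ, 0 < ε → ∃ δ : ℝ, 0 < δ ∧ ∀ θ₀ t : ℝ, 0 < t → t < δ →
      ∀ᶠ n in atTop, meanOsc (F n) θ₀ t ≤ ε) : IsVMO G := by
  have hGm : AEStronglyMeasurable G := aestronglyMeasurable_of_tendsto_ae atTop hF hG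
  have hGB : ∀ᵐ θ, ‖G θ‖ ≤ B := by
    filter_upwards [hG] with θ h
    exact le_of_tendsto h.norm (Eventually.of_forall fun n => hB n θ)
  have havg : ∀ θ₀ t, Tendsto (fun n => arcAvg (F n) θ₀ t) atTop (𝓝 (arcAvg G θ₀ t)) := by
    intro θ₀ t
    unfold arcAvg
    refine Tendsto.const_smul ?_ _
    refine tendsto_integral_of_dominated_convergence (fun _ => B) (fun n => (hF n).restrict)
      (integrableOn_const_arc B θ₀ t) (fun n => ae_of_all _ (hB n)) (ae_restrict_of_ae hG)
  have hB0 : 0 ≤ B := (norm_nonneg _).trans (hB 0 0)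
  have havB : ∀ n θ₀ t, 0 < t → ‖arcAvg (F n) θ₀ t‖ ≤ B := by
    intro n θ₀ t ht
    have hp : 0 < 2 * Real.pi * t := by positivity
    have h2 : θ₀ + Real.pi * t - (θ₀ - Real.pi * t) = 2 * Real.pi * t := by ring
    have := norm_setIntegral_le_of_norm_le_const (μ := volume)
      (s := Ioo (θ₀ - Real.pi * t) (θ₀ + Real.pi * t)) (f := F n) (C := B) (by simp)
      (fun x _ => hB n x)
    rw [Measure.real, Real.volume_Ioo, h2, ENNReal.toReal_ofReal hp.le] at this
    rw [arcAvg, norm_smul, Real.norm_of_nonneg (by positivity), inv_mul_le_iff₀ hp]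
    linarith
  have hmean : ∀ θ₀ t, 0 < t →
      Tendsto (fun n => meanOsc (F n) θ₀ t) atTop (𝓝 (meanOsc G θ₀ t)) := by
    intro θ₀ t ht
    unfold meanOsc
    refine Tendsto.const_mul _ ?_
    refine tendsto_integral_of_dominated_convergence (fun _ => B + B) (fun n => ?_)
      (integrableOn_const_arc (B + B) θ₀ t) (fun n => ae_of_all _ fun θ => ?_) ?_
    · exact ((hF n).restrict.sub aestronglyMeasurable_const).norm
    · rw [norm_norm]
      exact (norm_sub_le _ _).trans (add_le_add (hB n θ) (havB n θ₀ t ht))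
    · filter_upwards [ae_restrict_of_ae hG] with θ hθ
      exact (hθ.sub (havg θ₀ t)).norm
  refine ⟨⟨hper, ?_, 2 * B, fun θ₀ t ht _ => ?_⟩, fun ε hε => ?_⟩
  · exact Measure.integrableOn_of_bounded measure_Ioc_lt_top.ne hGm (ae_restrict_of_ae hGB)
  · refine le_of_tendsto (hmean θ₀ t ht) (Eventually.of_forall fun n => ?_)
    have hi := integrableOn_of_bound (hF n) (hB n)
      (volume_arc_ne_top (θ₀ - Real.pi * t) (θ₀ + Real.pi * t))
    refine (meanOsc_le_two_mul 0 ht hi).trans ?_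
    gcongr
    refine (arcMean_mono ht (by simpa [IntegrableOn] using hi.norm) (integrableOn_const_arc B θ₀ t)
      (fun θ _ => by simpa using hB n θ)).trans_eq (arcMean_const _ _ ht)
  · obtain ⟨δ, hδ, h⟩ := hosc ε hε
    exact ⟨δ, hδ, fun θ₀ t ht htδ => le_of_tendsto (hmean θ₀ t ht) (h θ₀ t ht htδ)⟩

lemma ae_of_ae_restrict_periodic {p : ℝ → Prop} (hp : ∀ θ, p (θ + 2 * Real.pi) ↔ p θ)
    (h : ∀ᵐ θ ∂(volume.restrict (Ioc 0 (2 * Real.pi))), p θ) : ∀ᵐ θ, p θ := by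
  rw [ae_restrict_iff' measurableSet_Ioc] at h
  have hz : ∀ (k : ℤ) θ, p (θ + k * (2 * Real.pi)) ↔ p θ := by
    have : Function.Periodic p (2 * Real.pi) := fun θ => propext (hp θ)
    intro k θ
    exact iff_of_eq (this.int_mul k θ)
  have h2 : ∀ᵐ θ, ∀ k : ℤ, θ + k * (2 * Real.pi) ∈ Ioc 0 (2 * Real.pi) →
      p (θ + k * (2 * Real.pi)) := by
    rw [ae_all_iff]
    intro k
    exact (measurePreserving_add_right volume ((k : ℝ) * (2 * Real.pi))).quasiMeasurePreserving.ae h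
  filter_upwards [h2] with θ hθ
  obtain ⟨k, hk, -⟩ := existsUnique_add_zsmul_mem_Ioc Real.two_pi_pos θ 0
  rw [zero_add, zsmul_eq_mul] at hk
  exact (hz k θ).1 (hθ k hk)

/-- The integral of a nonnegative periodic function over an arc of normalized length at most `1`
is bounded by its integral over a period. -/
lemma setIntegral_arc_le {u : ℝ → ℝ} (hper : Function.Periodic u (2 * Real.pi))
    (hu : ∀ θ, 0 ≤ u θ) (hi : IntervalIntegrable u volume 0 (2 * Real.pi)) {t : ℝ} (ht : t ≤ 1)
    (θ₀ : ℝ) :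
    ∫ θ in Ioo (θ₀ - Real.pi * t) (θ₀ + Real.pi * t), u θ ≤ ∫ θ in 0..(2 * Real.pi), u θ := by
  have hpi := Real.pi_pos
  have h1 := hper.intervalIntegral_add_eq 0 (θ₀ - Real.pi)
  rw [zero_add] at h1
  rw [h1, intervalIntegral.integral_of_le (by linarith)]
  have h2 := hper.intervalIntegrable₀ Real.two_pi_pos.ne' hi (θ₀ - Real.pi)
    (θ₀ - Real.pi + 2 * Real.pi)
  refine setIntegral_mono_set ?_ (ae_of_all _ hu) ?_
  · rwa [intervalIntegrable_iff_integrableOn_Ioc_of_le (by linarith)] at h2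
  · refine LE.le.eventuallyLE fun x hx => ⟨?_, ?_⟩
    · nlinarith [hx.1]
    · nlinarith [hx.2]

/-- `F` is complex differentiable at every point of the closed unit disc. -/
def RegularOnClosedDisc (F : ℂ → ℂ) : Prop := ∀ z, ‖z‖ ≤ 1 → DifferentiableAt ℂ F z

lemma RegularOnClosedDisc.diffContOnCl {F : ℂ → ℂ} (hF : RegularOnClosedDisc F) :
    DiffContOnCl ℂ F (Metric.ball 0 1) := by
  refine ⟨fun z hz => (hF z ?_).differentiableWithinAt,
    fun z hz => (hF z ?_).continuousAt.continuousWithinAt⟩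
  · exact (mem_ball_zero_iff.1 hz).le
  · rw [closure_ball _ one_ne_zero] at hz
    exact mem_closedBall_zero_iff.1 hz

lemma RegularOnClosedDisc.continuous_circlePt {F : ℂ → ℂ} (hF : RegularOnClosedDisc F) :
    Continuous fun θ => F (circlePt θ) :=
  continuous_iff_continuousAt.2 fun θ =>
    ContinuousAt.comp (f := circlePt) (hF _ (norm_circlePt θ).le).continuousAt
      _root_.continuous_circlePt.continuousAt

/-- The Poisson kernel of the unit disc. -/
def diskPoisson (z : ℂ) (θ : ℝ) : ℝ := (1 - ‖z‖ ^ 2) / ‖circlePt θ - z‖ ^ 2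

lemma circlePt_sub_ne_zero {z : ℂ} (hz : ‖z‖ < 1) (θ : ℝ) : circlePt θ - z ≠ 0 := by
  intro h
  rw [sub_eq_zero] at h
  rw [← h, norm_circlePt] at hz
  exact lt_irrefl _ hz

lemma continuous_diskPoisson {z : ℂ} (hz : ‖z‖ < 1) : Continuous (diskPoisson z) := by
  unfold diskPoisson
  refine continuous_const.div ((continuous_circlePt.sub continuous_const).norm.pow 2) fun θ => ?_
  have := norm_pos_iff.2 (circlePt_sub_ne_zero hz θ)
  positivity

lemma diskPoisson_nonneg {z : ℂ} (hz : ‖z‖ < 1) (θ : ℝ) : 0 ≤ diskPoisson z θ := by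
  unfold diskPoisson
  have : ‖z‖ ^ 2 ≤ 1 := pow_le_one₀ (norm_nonneg _) hz.le
  have : 0 ≤ 1 - ‖z‖ ^ 2 := by linarith
  positivity

lemma periodic_diskPoisson (z : ℂ) : Function.Periodic (diskPoisson z) (2 * Real.pi) := by
  intro θ
  simp only [diskPoisson, circlePt_add_two_pi]

/-- Poisson's formula. -/
lemma integral_diskPoisson_mul {F : ℂ → ℂ} (hF : RegularOnClosedDisc F) {z : ℂ} (hz : ‖z‖ < 1) :
    ((2 * Real.pi)⁻¹ : ℝ) • ∫ θ in 0..(2 * Real.pi), (diskPoisson z θ : ℂ) * F (circlePt θ)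
      = F z := by
  have := hF.diffContOnCl.circleAverage_poissonKernel_smul (mem_ball_zero_iff.2 hz)
  rw [← this, Real.circleAverage_def]
  simp [diskPoisson, poissonKernel, circlePt_eq_circleMap]

lemma integral_diskPoisson_mul_re {F : ℂ → ℂ} (hF : RegularOnClosedDisc F) {z : ℂ}
    (hz : ‖z‖ < 1) :
    (2 * Real.pi)⁻¹ * ∫ θ in 0..(2 * Real.pi), diskPoisson z θ * (F (circlePt θ)).re
      = (F z).re := by
  have h := integral_diskPoisson_mul hF hz
  have hi : IntervalIntegrable (fun θ => (diskPoisson z θ : ℂ) * F (circlePt θ)) volume 0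
      (2 * Real.pi) :=
    ((Complex.continuous_ofReal.comp (continuous_diskPoisson hz)).mul
      hF.continuous_circlePt).intervalIntegrable _ _
  rw [← h, Complex.smul_re, smul_eq_mul]
  congr 1
  have := Complex.reCLM.intervalIntegral_comp_comm hi
  simpa [Complex.re_ofReal_mul] using this

lemma integral_diskPoisson {z : ℂ} (hz : ‖z‖ < 1) :
    ∫ θ in 0..(2 * Real.pi), diskPoisson z θ = 2 * Real.pi := by
  have := integral_diskPoisson_mul_re (F := fun _ => 1)
    (fun z _ => differentiableAt_const _) hz
  simp only [Complex.one_re, mul_one] at this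
  rw [inv_mul_eq_one₀ (by positivity)] at this
  exact this.symm

lemma norm_circlePt_sub_circlePt_le (a b : ℝ) : ‖circlePt a - circlePt b‖ ≤ |a - b| := by
  have h : circlePt a - circlePt b = circlePt b * (Complex.exp (Complex.I * ((a - b : ℝ) : ℂ)) - 1) := by
    rw [mul_sub, mul_one, circlePt, circlePt, ← Complex.exp_add]
    congr 2
    push_cast; ring
  rw [h, norm_mul, norm_circlePt, one_mul]
  exact Real.norm_exp_I_mul_ofReal_sub_one_le

/-- The point of the disc lying over the arc of center `e^{iθ₀}` and normalized length `t`. -/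
def arcPt (θ₀ t : ℝ) : ℂ := ((1 - t / 2 : ℝ) : ℂ) * circlePt θ₀

lemma norm_arcPt (θ₀ : ℝ) {t : ℝ} (ht1 : t ≤ 1) : ‖arcPt θ₀ t‖ = 1 - t / 2 := by
  rw [arcPt, norm_mul, norm_circlePt, mul_one, Complex.norm_real, Real.norm_of_nonneg]
  linarith

lemma norm_arcPt_lt (θ₀ : ℝ) {t : ℝ} (ht : 0 < t) (ht1 : t ≤ 1) : ‖arcPt θ₀ t‖ < 1 := by
  rw [norm_arcPt θ₀ ht1]; linarith

lemma le_diskPoisson_arcPt {θ₀ t θ : ℝ} (ht : 0 < t) (ht1 : t ≤ 1)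
    (hθ : θ ∈ Ioo (θ₀ - Real.pi * t) (θ₀ + Real.pi * t)) :
    (32 * t)⁻¹ ≤ diskPoisson (arcPt θ₀ t) θ := by
  have h1 : ‖circlePt θ - arcPt θ₀ t‖ ≤ 4 * t := by
    have e : circlePt θ - arcPt θ₀ t
        = (circlePt θ - circlePt θ₀) + ((t / 2 : ℝ) : ℂ) * circlePt θ₀ := by
      rw [arcPt]; push_cast; ring
    rw [e]
    refine (norm_add_le _ _).trans ?_
    rw [norm_mul, norm_circlePt, mul_one, Complex.norm_real, Real.norm_of_nonneg (by linarith)]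
    have h2 := norm_circlePt_sub_circlePt_le θ θ₀
    have h3 : |θ - θ₀| ≤ Real.pi * t := abs_le.2 ⟨by linarith [hθ.1], by linarith [hθ.2]⟩
    have := Real.pi_lt_d2
    nlinarith
  have h0 := norm_pos_iff.2 (circlePt_sub_ne_zero (norm_arcPt_lt θ₀ ht ht1) θ)
  rw [diskPoisson, norm_arcPt θ₀ ht1, le_div_iff₀ (by positivity), inv_mul_le_iff₀ (by positivity)]
  have h2 := pow_le_pow_left₀ (norm_nonneg _) h1 2
  nlinarith [mul_nonneg (sq_nonneg t) (sub_nonneg.2 ht1), sq_nonneg t]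

lemma arcMean_re_le {F : ℂ → ℂ} (hF : RegularOnClosedDisc F)
    (hpos : ∀ θ, 0 ≤ (F (circlePt θ)).re) (θ₀ : ℝ) {t : ℝ} (ht : 0 < t) (ht1 : t ≤ 1) :
    arcMean (fun θ => (F (circlePt θ)).re) θ₀ t ≤ 32 * (F (arcPt θ₀ t)).re := by
  have hz := norm_arcPt_lt θ₀ ht ht1
  have hc : Continuous fun θ => (F (circlePt θ)).re :=
    Complex.continuous_re.comp hF.continuous_circlePt
  have hPc : Continuous fun θ => diskPoisson (arcPt θ₀ t) θ * (F (circlePt θ)).re :=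
    (continuous_diskPoisson hz).mul hc
  have h1 := setIntegral_arc_le (u := fun θ => diskPoisson (arcPt θ₀ t) θ * (F (circlePt θ)).re)
    (fun θ => by simp only [periodic_diskPoisson (arcPt θ₀ t) θ, circlePt_add_two_pi])
    (fun θ => mul_nonneg (diskPoisson_nonneg hz θ) (hpos θ)) (hPc.intervalIntegrable _ _) ht1 θ₀
  have h2 : (32 * t)⁻¹ * ∫ θ in Ioo (θ₀ - Real.pi * t) (θ₀ + Real.pi * t), (F (circlePt θ)).re ≤
      ∫ θ in Ioo (θ₀ - Real.pi * t) (θ₀ + Real.pi * t),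
        diskPoisson (arcPt θ₀ t) θ * (F (circlePt θ)).re := by
    rw [← integral_const_mul]
    refine setIntegral_mono_on ?_ ?_ measurableSet_Ioo fun θ hθ =>
      mul_le_mul_of_nonneg_right (le_diskPoisson_arcPt ht ht1 hθ) (hpos θ)
    · exact ((continuous_const.mul hc).integrableOn_Icc).mono_set Ioo_subset_Icc_self
    · exact hPc.integrableOn_Icc.mono_set Ioo_subset_Icc_self
  have h3 := integral_diskPoisson_mul_re hF hz
  have hpi := Real.pi_pos
  rw [inv_mul_eq_iff_eq_mul₀ (by positivity)] at h3
  have h4 := h2.trans (h1.trans_eq h3)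
  rw [arcMean]
  rw [inv_mul_le_iff₀ (by positivity)] at h4 ⊢
  linarith

/-- A function regular on the closed disc whose imaginary part is bounded by `τ` has mean
oscillation at most a constant times `τ`. -/
lemma arcMean_norm_sub_le {S : ℂ → ℂ} (hS : RegularOnClosedDisc S) {τ : ℝ} (hτ : 0 < τ)
    (him : ∀ θ, |(S (circlePt θ)).im| ≤ τ) (θ₀ : ℝ) {t : ℝ} (ht : 0 < t) (ht1 : t ≤ 1) :
    arcMean (fun θ => ‖S (circlePt θ) - S (arcPt θ₀ t)‖) θ₀ t ≤ 8 * τ := by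
  set a := S (arcPt θ₀ t) with ha
  set Q : ℂ → ℂ := fun z => (S z - a) ^ 2 + 4 * (a.im : ℂ) * Complex.I * S z
    + (2 * a.im ^ 2 + 2 * τ ^ 2 : ℝ) with hQ
  have hQr : RegularOnClosedDisc Q := fun z hz => by
    have := hS z hz
    simp only [hQ]
    fun_prop
  have key : ∀ θ, ‖S (circlePt θ) - a‖ ^ 2 ≤ (Q (circlePt θ)).re := by
    intro θ
    have h1 := sq_le_sq' (abs_le.1 (him θ)).1 (abs_le.1 (him θ)).2
    rw [← Complex.normSq_eq_norm_sq, Complex.normSq_apply]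
    simp only [hQ, Complex.add_re, Complex.ofReal_re, Complex.mul_re, Complex.mul_im, pow_two,
      Complex.sub_re, Complex.sub_im, Complex.I_re, Complex.I_im, Complex.ofReal_im,
      Complex.re_ofNat, Complex.im_ofNat]
    nlinarith
  have hval : (Q (arcPt θ₀ t)).re ≤ 2 * τ ^ 2 := by
    simp only [hQ, ← ha, Complex.add_re, Complex.ofReal_re, Complex.mul_re, Complex.mul_im, pow_two,
      Complex.sub_re, Complex.sub_im, Complex.I_re, Complex.I_im, Complex.ofReal_im,
      Complex.re_ofNat, Complex.im_ofNat]
    nlinarith [sq_nonneg a.im]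
  have h1 := arcMean_re_le hQr (fun θ => (sq_nonneg _).trans (key θ)) θ₀ ht ht1
  have hSc := hS.continuous_circlePt
  have hQc : Continuous fun θ => (Q (circlePt θ)).re :=
    Complex.continuous_re.comp hQr.continuous_circlePt
  have hio : ∀ {u : ℝ → ℝ}, Continuous u →
      IntegrableOn u (Ioo (θ₀ - Real.pi * t) (θ₀ + Real.pi * t)) := fun hu =>
    hu.integrableOn_Icc.mono_set Ioo_subset_Icc_self
  have hQc' : Continuous fun θ => (16 * τ)⁻¹ * (Q (circlePt θ)).re := continuous_const.mul hQc
  have h2 : arcMean (fun θ => ‖S (circlePt θ) - a‖) θ₀ t ≤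
      arcMean (fun θ => (16 * τ)⁻¹ * (Q (circlePt θ)).re + 4 * τ) θ₀ t := by
    refine arcMean_mono ht (hio (hSc.sub continuous_const).norm)
      (hio (hQc'.add continuous_const)) fun θ _ => ?_
    have h3 : ‖S (circlePt θ) - a‖ ≤ (16 * τ)⁻¹ * ‖S (circlePt θ) - a‖ ^ 2 + 4 * τ := by
      have : (16 * τ)⁻¹ * ‖S (circlePt θ) - a‖ ^ 2 + 4 * τ - ‖S (circlePt θ) - a‖
          = (16 * τ)⁻¹ * (‖S (circlePt θ) - a‖ - 8 * τ) ^ 2 := by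
        field_simp; ring
      have : 0 ≤ (16 * τ)⁻¹ * (‖S (circlePt θ) - a‖ - 8 * τ) ^ 2 := by positivity
      linarith
    refine h3.trans ?_
    gcongr
    exact key θ
  rw [arcMean_add (hio hQc') (hio continuous_const), arcMean_const_mul,
    arcMean_const _ _ ht] at h2
  have h4 : (16 * τ)⁻¹ * arcMean (fun θ => (Q (circlePt θ)).re) θ₀ t ≤ 4 * τ := by
    rw [inv_mul_le_iff₀ (by positivity)]
    nlinarith
  linarith

/-- Schwarz's formula: a function regular on the closed disc and real at the origin is the Herglotz
integral of its real part on the circle. -/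
lemma integral_herglotz_re {F : ℂ → ℂ} (hF : RegularOnClosedDisc F) (h0 : (F 0).im = 0) {z : ℂ}
    (hz : ‖z‖ < 1) :
    ((2 * Real.pi)⁻¹ : ℝ) • ∫ θ in 0..(2 * Real.pi),
      ((circlePt θ + z) / (circlePt θ - z)) * ((F (circlePt θ)).re : ℂ) = F z := by
  set A : (ℝ → ℂ) → ℂ := fun u => ((2 * Real.pi)⁻¹ : ℝ) • ∫ θ in 0..(2 * Real.pi), u θ with hA
  have hFc := hF.continuous_circlePt
  have hk : Continuous fun θ => (circlePt θ + z) / (circlePt θ - z) :=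
    (continuous_circlePt.add continuous_const).div (continuous_circlePt.sub continuous_const)
      (circlePt_sub_ne_zero hz)
  have hmv : ∀ {G : ℂ → ℂ}, RegularOnClosedDisc G → A (fun θ => G (circlePt θ)) = G 0 := by
    intro G hG
    have := DiffContOnCl.circleAverage (R := 1) (c := 0) (f := G) (by
      rw [abs_one]; exact hG.diffContOnCl)
    rw [← this, Real.circleAverage_def]
    simp only [hA, circlePt_eq_circleMap]
  have hca : A (fun θ => circlePt θ / (circlePt θ - z) * F (circlePt θ)) = F z := by
    have := DiffContOnCl.circleAverage_smul_div (R := 1) (c := 0) (f := F) (w := z) (by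
      rw [abs_one]; exact hF.diffContOnCl) (by simpa using hz)
    rw [← this, Real.circleAverage_def]
    simp only [hA, circlePt_eq_circleMap, sub_zero, smul_eq_mul]
  have h1 : A (fun θ => (circlePt θ + z) / (circlePt θ - z) * F (circlePt θ)) = 2 * F z - F 0 := by
    have e : (fun θ => (circlePt θ + z) / (circlePt θ - z) * F (circlePt θ)) =
        fun θ => 2 * (circlePt θ / (circlePt θ - z) * F (circlePt θ)) - F (circlePt θ) := by
      funext θ
      have := circlePt_sub_ne_zero hz θ
      field_simp
      ring
    have hc2 : Continuous fun θ => circlePt θ / (circlePt θ - z) * F (circlePt θ) :=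
      (continuous_circlePt.div (continuous_circlePt.sub continuous_const)
        (circlePt_sub_ne_zero hz)).mul hFc
    have hc3 : Continuous fun θ => 2 * (circlePt θ / (circlePt θ - z) * F (circlePt θ)) :=
      continuous_const.mul hc2
    rw [e, ← hmv hF, ← hca]
    simp only [hA]
    rw [intervalIntegral.integral_sub (hc3.intervalIntegrable _ _)
      (hFc.intervalIntegrable _ _), intervalIntegral.integral_const_mul, smul_sub,
      mul_smul_comm]
  have h2 : A (fun θ => (circlePt θ + z) / (circlePt θ - z) * (starRingEnd ℂ) (F (circlePt θ)))
      = F 0 := by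
    have hne : ∀ w : ℂ, ‖w‖ ≤ 1 → 1 - (starRingEnd ℂ) z * w ≠ 0 := by
      intro w hw h
      rw [sub_eq_zero] at h
      have : ‖(starRingEnd ℂ) z * w‖ < 1 := by
        rw [norm_mul, Complex.norm_conj]
        nlinarith [norm_nonneg w, norm_nonneg z]
      rw [← h, norm_one] at this
      exact lt_irrefl _ this
    have hG : RegularOnClosedDisc fun w =>
        (1 + (starRingEnd ℂ) z * w) / (1 - (starRingEnd ℂ) z * w) * F w := fun w hw => by
      have := hF w hw
      have := hne w hw
      fun_prop (disch := assumption)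
    have h3 := hmv hG
    simp only [mul_zero, add_zero, sub_zero, div_one, one_mul] at h3
    have h4 := congrArg (starRingEnd ℂ) h3
    rw [Complex.conj_eq_iff_im.2 h0] at h4
    rw [← h4]
    simp only [hA, Complex.real_smul, map_mul, Complex.conj_ofReal]
    congr 1
    rw [intervalIntegral.integral_of_le Real.two_pi_pos.le,
      intervalIntegral.integral_of_le Real.two_pi_pos.le, ← integral_conj]
    refine integral_congr_ae (ae_of_all _ fun θ => ?_)
    have hc : circlePt θ * (starRingEnd ℂ) (circlePt θ) = 1 := by
      rw [Complex.mul_conj, Complex.normSq_eq_norm_sq, norm_circlePt]; simp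
    simp only [map_mul, map_div₀, map_add, map_sub, map_one, Complex.conj_conj]
    congr 1
    have hz1 := circlePt_sub_ne_zero hz θ
    have hz2 : 1 - z * (starRingEnd ℂ) (circlePt θ) ≠ 0 := by
      intro h
      apply hz1
      linear_combination circlePt θ * h + z * hc
    rw [div_eq_div_iff hz1 hz2]
    linear_combination (-2 * z) * hc
  have hre : (fun θ => ((circlePt θ + z) / (circlePt θ - z)) * ((F (circlePt θ)).re : ℂ)) =
      fun θ => (1 / 2 : ℂ) * ((circlePt θ + z) / (circlePt θ - z) * F (circlePt θ)
        + (circlePt θ + z) / (circlePt θ - z) * (starRingEnd ℂ) (F (circlePt θ))) := by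
    funext θ
    rw [Complex.re_eq_add_conj]; ring
  change A _ = _
  rw [hre]
  have hci : ∀ {u : ℝ → ℂ}, Continuous u → IntervalIntegrable u volume 0 (2 * Real.pi) :=
    fun h => h.intervalIntegrable _ _
  have hk1 : Continuous fun θ => (circlePt θ + z) / (circlePt θ - z) * F (circlePt θ) := hk.mul hFc
  have hk2 : Continuous fun θ =>
      (circlePt θ + z) / (circlePt θ - z) * (starRingEnd ℂ) (F (circlePt θ)) :=
    hk.mul (Complex.continuous_conj.comp hFc)
  have : A (fun θ => (1 / 2 : ℂ) * ((circlePt θ + z) / (circlePt θ - z) * F (circlePt θ)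
        + (circlePt θ + z) / (circlePt θ - z) * (starRingEnd ℂ) (F (circlePt θ))))
      = (1 / 2) * (A (fun θ => (circlePt θ + z) / (circlePt θ - z) * F (circlePt θ)) +
        A (fun θ => (circlePt θ + z) / (circlePt θ - z) * (starRingEnd ℂ) (F (circlePt θ)))) := by
    simp only [hA]
    rw [intervalIntegral.integral_const_mul, intervalIntegral.integral_add (hci hk1)
      (hci hk2), Complex.real_smul, Complex.real_smul, Complex.real_smul]
    ring
  rw [this, h1, h2]
  ring

lemma abs_sub_le_pi_mul_norm_circlePt_sub {a b : ℝ} (h : |a - b| ≤ Real.pi) :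
    2 * |a - b| ≤ Real.pi * ‖circlePt a - circlePt b‖ := by
  have h1 : circlePt a - circlePt b
      = circlePt b * (Complex.exp (Complex.I * ((a - b : ℝ) : ℂ)) - 1) := by
    rw [mul_sub, mul_one, circlePt, circlePt, ← Complex.exp_add]
    congr 2
    push_cast; ring
  rw [h1, norm_mul, norm_circlePt, one_mul, Complex.norm_exp_I_mul_ofReal_sub_one, norm_mul,
    Real.norm_eq_abs, Real.norm_eq_abs, abs_two]
  have h2 := Real.mul_le_sin (x := |a - b| / 2) (by positivity) (by linarith)
  have h3 : Real.sin (|a - b| / 2) ≤ |Real.sin ((a - b) / 2)| := by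
    rcases abs_cases (a - b) with ⟨e, _⟩ | ⟨e, _⟩ <;> rw [e]
    · exact le_abs_self _
    · rw [neg_div, Real.sin_neg]; exact neg_le_abs _
  have hpi := Real.pi_pos
  have h4 : 2 / Real.pi * (|a - b| / 2) = |a - b| / Real.pi := by field_simp
  rw [h4, div_le_iff₀ hpi] at h2
  nlinarith

/-- Pointwise comparison of Poisson kernels on a common radius, away from that radius. -/
lemma diskPoisson_le_of_far {θ₀ θ ε L : ℝ} (hε : 0 < ε) (hL : 1 ≤ L) (hLε : L * ε ≤ 1)
    (h1 : L * ε ≤ |θ - θ₀|) (h2 : |θ - θ₀| ≤ Real.pi) :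
    diskPoisson ((1 - ε : ℝ) * circlePt θ₀) θ
      ≤ 8 * Real.pi ^ 2 / L * diskPoisson ((1 - L * ε : ℝ) * circlePt θ₀) θ := by
  have hpi := Real.pi_pos
  have hε1 : ε ≤ 1 := by nlinarith
  have hLε0 : 0 < L * ε := by positivity
  have e : ∀ s : ℝ, circlePt θ - ((1 - s : ℝ) : ℂ) * circlePt θ₀
        = (circlePt θ - circlePt θ₀) + (s : ℂ) * circlePt θ₀ := by
    intro s; push_cast; ring
  have hn : ∀ s : ℝ, 0 ≤ s → ‖(s : ℂ) * circlePt θ₀‖ = s := by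
    intro s hs
    rw [norm_mul, norm_circlePt, mul_one, Complex.norm_real, Real.norm_of_nonneg hs]
  have hd := abs_sub_le_pi_mul_norm_circlePt_sub h2
  set d := ‖circlePt θ - circlePt θ₀‖ with hd'
  have hdle : d ≤ |θ - θ₀| := norm_circlePt_sub_circlePt_le θ θ₀
  set x := ‖circlePt θ - ((1 - ε : ℝ) : ℂ) * circlePt θ₀‖ with hx
  set y := ‖circlePt θ - ((1 - L * ε : ℝ) : ℂ) * circlePt θ₀‖ with hy
  have hy1 : y ≤ 2 * |θ - θ₀| := by
    rw [hy, e]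
    refine (norm_add_le _ _).trans ?_
    rw [hn _ hLε0.le]; linarith
  have hxε : ε ≤ x := by
    have h3 := norm_sub_norm_le (circlePt θ) (((1 - ε : ℝ) : ℂ) * circlePt θ₀)
    rw [hn _ (by linarith), norm_circlePt] at h3
    linarith
  have hy0 : L * ε ≤ y := by
    have h3 := norm_sub_norm_le (circlePt θ) (((1 - L * ε : ℝ) : ℂ) * circlePt θ₀)
    rw [hn _ (by linarith), norm_circlePt] at h3
    linarith
  have hx1 : d ≤ 2 * x := by
    have h3 : circlePt θ - circlePt θ₀ = (circlePt θ - ((1 - ε : ℝ) : ℂ) * circlePt θ₀)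
        - (ε : ℂ) * circlePt θ₀ := by push_cast; ring
    have h4 : d ≤ x + ε := by
      rw [hd', h3]
      refine (norm_sub_le _ _).trans ?_
      rw [hn _ hε.le]
    linarith
  have hyx : y ≤ 2 * Real.pi * x := by nlinarith
  have hx0 : 0 < x := by linarith
  have hy0' : 0 < y := by linarith
  rw [diskPoisson, diskPoisson, ← hx, ← hy, hn _ (by linarith), hn _ (by linarith),
    div_le_iff₀ (by positivity)]
  have h5 : y ^ 2 ≤ 4 * Real.pi ^ 2 * x ^ 2 := by
    have := pow_le_pow_left₀ hy0'.le hyx 2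
    nlinarith
  have h6 : 1 - (1 - ε) ^ 2 ≤ 2 * ε := by nlinarith
  have h7 : L * ε ≤ 1 - (1 - L * ε) ^ 2 := by nlinarith
  have h8 : 1 ≤ 4 * Real.pi ^ 2 * x ^ 2 / y ^ 2 := (one_le_div (by positivity)).2 h5
  calc 1 - (1 - ε) ^ 2 ≤ 2 * ε * 1 := by linarith
    _ ≤ 2 * ε * (4 * Real.pi ^ 2 * x ^ 2 / y ^ 2) := by gcongr
    _ = 8 * Real.pi ^ 2 / L * (L * ε / y ^ 2) * x ^ 2 := by field_simp; ring
    _ ≤ _ := by gcongr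

lemma diskPoisson_le_two_div {θ₀ θ ε : ℝ} (hε : 0 < ε) (hε1 : ε ≤ 1) :
    diskPoisson ((1 - ε : ℝ) * circlePt θ₀) θ ≤ 2 / ε := by
  have hn : ‖((1 - ε : ℝ) : ℂ) * circlePt θ₀‖ = 1 - ε := by
    rw [norm_mul, norm_circlePt, mul_one, Complex.norm_real, Real.norm_of_nonneg (by linarith)]
  have hxε : ε ≤ ‖circlePt θ - ((1 - ε : ℝ) : ℂ) * circlePt θ₀‖ := by
    have h3 := norm_sub_norm_le (circlePt θ) (((1 - ε : ℝ) : ℂ) * circlePt θ₀)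
    rw [hn, norm_circlePt] at h3
    linarith
  have hx0 := hε.trans_le hxε
  rw [diskPoisson, hn, div_le_div_iff₀ (by positivity) hε]
  have := pow_le_pow_left₀ hε.le hxε 2
  nlinarith

/-- Quantitative form of Fatou's theorem. -/
lemma norm_poisson_sub_le {G : ℝ → ℂ} {B : ℝ} (hG : AEStronglyMeasurable G)
    (hB : ∀ θ, ‖G θ‖ ≤ B) (hper : ∀ θ, G (θ + 2 * Real.pi) = G θ) {θ₀ ε L : ℝ}
    (hε : 0 < ε) (hL : 1 ≤ L) (hLε : L * ε ≤ 1) (hε1 : ε < 1) :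
    ‖((2 * Real.pi)⁻¹ : ℝ) • (∫ θ in 0..(2 * Real.pi),
      (diskPoisson ((1 - ε : ℝ) * circlePt θ₀) θ : ℂ) * G θ) - G θ₀‖
      ≤ 2 * L / Real.pi * arcMean (fun θ => ‖G θ - G θ₀‖) θ₀ (L * ε / Real.pi) + 16 * Real.pi ^ 2 * B / L := by
  have hpi := Real.pi_pos
  have hp3 := Real.pi_gt_three
  have hLε0 : 0 < L * ε := by positivity
  have hB0 : 0 ≤ B := (norm_nonneg _).trans (hB 0)
  have hn : ∀ s : ℝ, 0 < s → s ≤ 1 → ‖((1 - s : ℝ) : ℂ) * circlePt θ₀‖ < 1 := by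
    intro s hs hs1
    rw [norm_mul, norm_circlePt, mul_one, Complex.norm_real, Real.norm_of_nonneg] <;> linarith
  set z := ((1 - ε : ℝ) : ℂ) * circlePt θ₀ with hz
  set z' := ((1 - L * ε : ℝ) : ℂ) * circlePt θ₀ with hz'
  have hz1 : ‖z‖ < 1 := hn ε hε hε1.le
  have hz1' : ‖z'‖ < 1 := hn _ hLε0 hLε
  have hPc := continuous_diskPoisson hz1
  have hPc' := continuous_diskPoisson hz1'
  have hPm : AEStronglyMeasurable (fun θ => (diskPoisson z θ : ℂ) * G θ) :=
    (Complex.continuous_ofReal.comp hPc).aestronglyMeasurable.mul hG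
  set I := Ioc (θ₀ - Real.pi) (θ₀ - Real.pi + 2 * Real.pi) with hI
  have hIf : volume I ≠ ⊤ := by
    rw [hI, Real.volume_Ioc]; exact ENNReal.ofReal_ne_top
  have hPB : ∀ θ, diskPoisson z θ ≤ 2 / ε := fun θ => diskPoisson_le_two_div hε hε1.le
  have hP0 := diskPoisson_nonneg hz1
  have hi1 : IntegrableOn (fun θ => (diskPoisson z θ : ℂ) * G θ) I := by
    refine integrableOn_of_bound (B := 2 / ε * B) hPm (fun θ => ?_) hIf
    rw [norm_mul, Complex.norm_real, Real.norm_of_nonneg (hP0 θ)]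
    exact mul_le_mul (hPB θ) (hB θ) (norm_nonneg _) (by positivity)
  have hi2 : IntegrableOn (fun θ => (diskPoisson z θ : ℂ) * G θ₀) I :=
    ((Complex.continuous_ofReal.comp hPc).mul continuous_const).integrableOn_Ioc
  set u : ℝ → ℝ := fun θ => ‖G θ - G θ₀‖ with hu
  have hu0 : ∀ θ, 0 ≤ u θ := fun θ => norm_nonneg _
  have huB : ∀ θ, u θ ≤ 2 * B := fun θ => by
    have := norm_sub_le (G θ) (G θ₀)
    have := hB θ
    have := hB θ₀
    simp only [hu]; linarith
  have hum : AEStronglyMeasurable u := (hG.sub aestronglyMeasurable_const).norm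
  have hper1 : Function.Periodic (fun θ => (diskPoisson z θ : ℂ) * G θ) (2 * Real.pi) := fun θ => by
    simp only [hper θ, periodic_diskPoisson z θ]
  have hone : ∀ w : ℂ, ‖w‖ < 1 → ∫ θ in I, diskPoisson w θ = 2 * Real.pi := by
    intro w hw
    rw [← integral_diskPoisson hw, ← intervalIntegral.integral_of_le (by linarith),
      (periodic_diskPoisson w).intervalIntegral_add_eq _ 0, zero_add]
  have hcst : ∫ θ in I, (diskPoisson z θ : ℂ) * G θ₀ = (2 * Real.pi : ℝ) • G θ₀ := by
    rw [integral_mul_const, integral_complex_ofReal, hone z hz1, Complex.real_smul]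
  have hsplit : ((2 * Real.pi)⁻¹ : ℝ) • (∫ θ in 0..(2 * Real.pi), (diskPoisson z θ : ℂ) * G θ) - G θ₀
      = ((2 * Real.pi)⁻¹ : ℝ) • ∫ θ in I, (diskPoisson z θ : ℂ) * (G θ - G θ₀) := by
    have h1 := hper1.intervalIntegral_add_eq 0 (θ₀ - Real.pi)
    rw [zero_add] at h1
    rw [h1, intervalIntegral.integral_of_le (by linarith), ← hI]
    simp only [mul_sub]
    rw [integral_sub hi1 hi2, hcst, smul_sub, smul_smul, inv_mul_cancel₀ (by positivity), one_smul]
  set A := Ioo (θ₀ - Real.pi * (L * ε / Real.pi)) (θ₀ + Real.pi * (L * ε / Real.pi)) with hA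
  have hAe : A = Ioo (θ₀ - L * ε) (θ₀ + L * ε) := by
    rw [hA, mul_div_cancel₀ _ hpi.ne']
  have hAI : A ⊆ I := by
    rw [hAe, hI]
    intro θ hθ
    constructor <;> [skip; skip] <;> linarith [hθ.1, hθ.2]
  have hiA : IntegrableOn u A :=
    integrableOn_of_bound (B := 2 * B) hum (fun θ => by
      rw [Real.norm_of_nonneg (hu0 θ)]; exact huB θ) (volume_arc_ne_top _ _)
  have hiAi : IntegrableOn (A.indicator u) I := by
    rw [hA, integrableOn_indicator_iff measurableSet_Ioo] 
    exact hiA.mono_set inter_subset_left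
  have hiP' : IntegrableOn (fun θ => 16 * Real.pi ^ 2 * B / L * diskPoisson z' θ) I :=
    (continuous_const.mul hPc').integrableOn_Ioc
  have hiR : IntegrableOn
      (fun θ => 2 / ε * A.indicator u θ + 16 * Real.pi ^ 2 * B / L * diskPoisson z' θ) I :=
    (hiAi.const_mul (2 / ε)).add hiP'
  have hbound : ‖∫ θ in I, (diskPoisson z θ : ℂ) * (G θ - G θ₀)‖ ≤
      ∫ θ in I, (2 / ε * A.indicator u θ + 16 * Real.pi ^ 2 * B / L * diskPoisson z' θ) := by
    refine norm_integral_le_of_norm_le hiR ?_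
    filter_upwards [ae_restrict_mem measurableSet_Ioc] with θ hθ
    rw [norm_mul, Complex.norm_real, Real.norm_of_nonneg (hP0 θ)]
    change diskPoisson z θ * u θ ≤ _
    have hP0' := diskPoisson_nonneg hz1' θ
    by_cases hθA : θ ∈ A
    · rw [indicator_of_mem hθA]
      have h1 := mul_le_mul_of_nonneg_right (hPB θ) (hu0 θ)
      have : 0 ≤ 16 * Real.pi ^ 2 * B / L * diskPoisson z' θ := by positivity
      linarith
    · rw [indicator_of_notMem hθA, mul_zero, zero_add]
      have h2 : |θ - θ₀| ≤ Real.pi := abs_le.2 ⟨by linarith [hθ.1], by linarith [hθ.2]⟩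
      have h3 : L * ε ≤ |θ - θ₀| := by
        by_contra h4
        rw [not_le, abs_lt] at h4
        exact hθA (hAe ▸ ⟨by linarith [h4.1], by linarith [h4.2]⟩)
      have h5 := diskPoisson_le_of_far hε hL hLε h3 h2
      calc diskPoisson z θ * u θ
          ≤ (8 * Real.pi ^ 2 / L * diskPoisson z' θ) * (2 * B) :=
            mul_le_mul h5 (huB θ) (hu0 θ) (by positivity)
        _ = _ := by ring
  rw [hsplit, norm_smul, Real.norm_of_nonneg (by positivity)]
  refine (mul_le_mul_of_nonneg_left hbound (by positivity)).trans_eq ?_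
  rw [integral_add (hiAi.const_mul (2 / ε)) hiP', integral_const_mul, integral_const_mul,
    hone z' hz1', hA, setIntegral_indicator measurableSet_Ioo, ← hA, inter_eq_right.2 hAI, arcMean,
    ← hA]
  field_simp

lemma ae_tendsto_arcMean {G : ℝ → ℂ} {B : ℝ} (hG : AEStronglyMeasurable G)
    (hB : ∀ θ, ‖G θ‖ ≤ B) :
    ∀ᵐ θ₀, Tendsto (fun t => arcMean (fun θ => ‖G θ - G θ₀‖) θ₀ t) (𝓝[>] 0) (𝓝 0) := by
  have hl : LocallyIntegrable G volume := by
    refine (locallyIntegrable_const (B : ℝ)).mono hG (ae_of_all _ fun θ => ?_)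
    rw [Real.norm_eq_abs]
    exact (hB θ).trans (le_abs_self _)
  filter_upwards [IsUnifLocDoublingMeasure.ae_tendsto_average_norm_sub volume hl 1] with θ₀ h
  have hlim : Tendsto (fun t : ℝ => Real.pi * t) (𝓝[>] 0) (𝓝[>] 0) := by
    refine tendsto_nhdsWithin_iff.2 ⟨?_, ?_⟩
    · have : Tendsto (fun t : ℝ => Real.pi * t) (𝓝 0) (𝓝 (Real.pi * 0)) := tendsto_id.const_mul _
      rw [mul_zero] at this
      exact this.mono_left nhdsWithin_le_nhds
    · filter_upwards [self_mem_nhdsWithin] with t ht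
      exact mul_pos Real.pi_pos ht
  have h1 := h (fun _ => θ₀) _ hlim (by
    filter_upwards [self_mem_nhdsWithin] with t ht
    have : (0:ℝ) < t := ht
    exact Metric.mem_closedBall_self (by positivity))
  refine h1.congr' ?_
  filter_upwards [self_mem_nhdsWithin] with t ht
  have ht : (0:ℝ) < t := ht
  have h2 : θ₀ + Real.pi * t - (θ₀ - Real.pi * t) = 2 * Real.pi * t := by ring
  rw [Real.closedBall_eq_Icc, setAverage_eq, arcMean, integral_Icc_eq_integral_Ioo, Measure.real,
    Real.volume_Icc, h2, ENNReal.toReal_ofReal (by positivity), smul_eq_mul]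

/-- Fatou's theorem for bounded functions. -/
lemma hasRadialLimits_of_poisson {F : ℂ → ℂ} {G : ℝ → ℂ} {B : ℝ} (hG : AEStronglyMeasurable G)
    (hB : ∀ θ, ‖G θ‖ ≤ B) (hper : ∀ θ, G (θ + 2 * Real.pi) = G θ)
    (hF : ∀ z, ‖z‖ < 1 →
      F z = ((2 * Real.pi)⁻¹ : ℝ) • ∫ θ in 0..(2 * Real.pi), (diskPoisson z θ : ℂ) * G θ) :
    HasRadialLimits F G := by
  have hpi := Real.pi_pos
  have hB0 : 0 ≤ B := (norm_nonneg _).trans (hB 0)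
  refine ae_restrict_of_ae ?_
  filter_upwards [ae_tendsto_arcMean hG hB] with θ₀ h
  have hsub : Tendsto (fun r : ℝ => 1 - r) (𝓝[<] 1) (𝓝[>] 0) := by
    refine tendsto_nhdsWithin_iff.2 ⟨?_, ?_⟩
    · have : Tendsto (fun r : ℝ => 1 - r) (𝓝 1) (𝓝 (1 - 1)) := tendsto_const_nhds.sub tendsto_id
      rw [sub_self] at this
      exact this.mono_left nhdsWithin_le_nhds
    · filter_upwards [self_mem_nhdsWithin] with r hr
      exact sub_pos.2 (mem_Iio.1 hr)
  have key : Tendsto (fun ε : ℝ => F (((1 - ε : ℝ) : ℂ) * circlePt θ₀)) (𝓝[>] 0) (𝓝 (G θ₀)) := by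
    rw [Metric.tendsto_nhds]
    intro η hη
    obtain ⟨L, hL1, hL2⟩ : ∃ L : ℝ, 1 ≤ L ∧ 16 * Real.pi ^ 2 * B / L < η / 2 := by
      refine ⟨max 1 (16 * Real.pi ^ 2 * B / (η / 2) + 1), le_max_left _ _, ?_⟩
      rw [div_lt_comm₀ (by positivity) (by positivity)]
      exact lt_of_lt_of_le (lt_add_one _) (le_max_right _ _)
    have hlim : Tendsto (fun ε : ℝ => L * ε / Real.pi) (𝓝[>] 0) (𝓝[>] 0) := by
      refine tendsto_nhdsWithin_iff.2 ⟨?_, ?_⟩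
      · have : Tendsto (fun ε : ℝ => L * ε / Real.pi) (𝓝 0) (𝓝 (L * 0 / Real.pi)) :=
          (tendsto_id.const_mul _).div_const _
        rw [mul_zero, zero_div] at this
        exact this.mono_left nhdsWithin_le_nhds
      · filter_upwards [self_mem_nhdsWithin] with t ht
        have ht : (0:ℝ) < t := ht
        exact mem_Ioi.2 (by positivity)
    have h1 := (h.comp hlim).eventually (gt_mem_nhds (show (0:ℝ) < η / 2 / (2 * L / Real.pi) by positivity))
    have h2 : ∀ᶠ ε : ℝ in 𝓝[>] 0, ε < 1 / L / 2 :=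
      (gt_mem_nhds (show (0:ℝ) < 1 / L / 2 by positivity)).filter_mono nhdsWithin_le_nhds
    filter_upwards [h1, h2, self_mem_nhdsWithin] with ε he1 he2 he3
    have he3 : 0 < ε := he3
    have hLε : L * ε ≤ 1 / 2 := by
      have := mul_le_mul_of_nonneg_left he2.le (show 0 ≤ L by linarith)
      rwa [div_div, mul_one_div, ← div_div, div_self (by linarith)] at this
    have hε1 : ε < 1 := by nlinarith
    rw [dist_eq_norm, hF _ (by
      rw [norm_mul, norm_circlePt, mul_one, Complex.norm_real, Real.norm_of_nonneg] <;> linarith)]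
    refine (norm_poisson_sub_le hG hB hper he3 hL1 (by linarith) hε1).trans_lt ?_
    simp only [Function.comp_apply] at he1
    rw [lt_div_iff₀ (by positivity)] at he1
    linarith
  refine (key.comp hsub).congr fun r => ?_
  simp

/-- A bounded measurable periodic function is approximated in mean by continuous functions on the
circle, which may be composed with a contraction towards the values of the function. -/
lemma exists_continuous_addCircle_approx [Fact (0 < 2 * Real.pi)] {f : ℝ → ℂ} {B : ℝ}
    (hf : Measurable f) (hper : ∀ θ, f (θ + 2 * Real.pi) = f θ) (hB : ∀ θ, ‖f θ‖ ≤ B)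
    {p : ℂ → ℂ} (hp : Continuous p) (hfp : ∀ θ w, ‖f θ - p w‖ ≤ ‖f θ - w‖) {η : ℝ} (hη : 0 < η) :
    ∃ G : C(AddCircle (2 * Real.pi), ℂ), (∀ x, ∃ w, G x = p w) ∧
      ∫ θ in 0..(2 * Real.pi), ‖f θ - G (θ : AddCircle (2 * Real.pi))‖ ≤ η := by
  set Fc : AddCircle (2 * Real.pi) → ℂ :=
    fun x => f (AddCircle.measurableEquivIoc (2 * Real.pi) 0 x) with hFc
  have hFm : Measurable Fc :=
    hf.comp (measurable_subtype_coe.comp (AddCircle.measurableEquivIoc (2 * Real.pi) 0).measurable)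
  have hFi : Integrable Fc volume :=
    Integrable.of_bound hFm.aestronglyMeasurable B (ae_of_all _ fun x => hB _)
  have hcoe : ∀ θ : ℝ, Fc (θ : AddCircle (2 * Real.pi)) = f θ := by
    intro θ
    have hP : Function.Periodic f (2 * Real.pi) := hper
    have h1 : (((AddCircle.measurableEquivIoc (2 * Real.pi) 0 (θ : AddCircle (2 * Real.pi))) : ℝ) :
        AddCircle (2 * Real.pi)) = θ :=
      (AddCircle.measurableEquivIoc (2 * Real.pi) 0).symm_apply_apply (θ : AddCircle (2 * Real.pi))
    have h2 := congrArg hP.lift h1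
    simpa only [Function.Periodic.lift_coe] using h2
  obtain ⟨G, hG, -⟩ := hFi.exists_boundedContinuous_integral_sub_le hη
  refine ⟨⟨fun x => p (G x), hp.comp G.continuous⟩, fun x => ⟨G x, rfl⟩, ?_⟩
  have h1 := AddCircle.intervalIntegral_preimage (2 * Real.pi) 0 (fun x => ‖Fc x - p (G x)‖)
  simp only [hcoe, zero_add] at h1
  simp only [ContinuousMap.coe_mk]
  rw [h1]
  refine le_trans (integral_mono_of_nonneg (ae_of_all _ fun x => norm_nonneg _)
    (Integrable.norm ?_) (ae_of_all _ fun x => hfp _ _)) hG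
  obtain ⟨C, hC⟩ := (isCompact_range G.continuous).isBounded.exists_norm_le
  exact hFi.sub (Integrable.of_bound G.continuous.aestronglyMeasurable C
    (ae_of_all _ fun x => hC _ ⟨x, rfl⟩))

lemma exists_continuous_periodic_approx {f : ℝ → ℂ} {B : ℝ}
    (hf : Measurable f) (hper : ∀ θ, f (θ + 2 * Real.pi) = f θ) (hB : ∀ θ, ‖f θ‖ ≤ B)
    {η : ℝ} (hη : 0 < η) :
    ∃ g : ℝ → ℂ, Continuous g ∧ (∀ θ, g (θ + 2 * Real.pi) = g θ) ∧ (∀ θ, ‖g θ‖ ≤ 2 * B) ∧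
      ∫ θ in 0..(2 * Real.pi), ‖f θ - g θ‖ ≤ η := by
  have : Fact (0 < 2 * Real.pi) := ⟨Real.two_pi_pos⟩
  have hB0 : 0 ≤ B := (norm_nonneg _).trans (hB 0)
  set k : ℝ → ℝ := fun x => max (-B) (min B x) with hk
  have hkc : Continuous k := continuous_const.max (continuous_const.min continuous_id)
  have hkb : ∀ x, |k x| ≤ B := fun x => abs_le.2
    ⟨le_max_left _ _, max_le (by linarith) (min_le_left _ _)⟩
  have hkl : ∀ a x, |a| ≤ B → |a - k x| ≤ |a - x| := by
    intro a x ha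
    have e : a = k a := by
      rw [hk]
      simp only
      rw [min_eq_right (abs_le.1 ha).2, max_eq_right (abs_le.1 ha).1]
    have h1 : |k a - k x| ≤ |min B a - min B x| := by
      simp only [hk]
      exact (abs_max_sub_max_le_max _ _ _ _).trans (by simp)
    have h2 : |min B a - min B x| ≤ |a - x| :=
      (abs_min_sub_min_le_max _ _ _ _).trans (by simp)
    calc |a - k x| = |k a - k x| := by rw [← e]
      _ ≤ _ := h1.trans h2
  obtain ⟨G, hG1, hG2⟩ := exists_continuous_addCircle_approx hf hper hB
    (p := fun w => ⟨k w.re, k w.im⟩) (by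
      have : (fun w : ℂ => (⟨k w.re, k w.im⟩ : ℂ)) =
          fun w : ℂ => ((k w.re : ℝ) : ℂ) + ((k w.im : ℝ) : ℂ) * Complex.I := by
        funext w; exact Complex.mk_eq_add_mul_I _ _
      rw [this]
      fun_prop) (fun θ w => by
      rw [Complex.norm_def, Complex.norm_def]
      refine Real.sqrt_le_sqrt ?_
      rw [Complex.normSq_apply, Complex.normSq_apply]
      have h1 := sq_le_sq.2 (hkl _ w.re ((Complex.abs_re_le_norm _).trans (hB θ)))
      have h2 := sq_le_sq.2 (hkl _ w.im ((Complex.abs_im_le_norm _).trans (hB θ)))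
      simp only [Complex.sub_re, Complex.sub_im]
      nlinarith) hη
  refine ⟨fun θ => G (θ : AddCircle (2 * Real.pi)),
    G.continuous.comp (AddCircle.continuous_mk' _), fun θ => ?_, fun θ => ?_, hG2⟩
  · simp only [AddCircle.coe_add_period]
  · obtain ⟨w, hw⟩ := hG1 (θ : AddCircle (2 * Real.pi))
    simp only [hw]
    refine (Complex.norm_le_abs_re_add_abs_im _).trans ?_
    have := hkb w.re
    have := hkb w.im
    linarith

/-- The real part of a trigonometric polynomial agrees with that of an entire function. -/
lemma exists_entire_of_mem_span_fourier [Fact (0 < 2 * Real.pi)]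
    {p : C(AddCircle (2 * Real.pi), ℂ)}
    (hp : p ∈ Submodule.span ℂ (range (@fourier (2 * Real.pi)))) :
    ∃ A B : ℂ → ℂ, Differentiable ℂ A ∧ Differentiable ℂ B ∧
      ∀ θ : ℝ, p (θ : AddCircle (2 * Real.pi))
        = A (circlePt θ) + (starRingEnd ℂ) (B (circlePt θ)) := by
  induction hp using Submodule.span_induction with
  | mem p hp =>
    obtain ⟨n, rfl⟩ := hp
    have hn : ∀ θ : ℝ, fourier n (θ : AddCircle (2 * Real.pi))
        = Complex.exp ((n : ℂ) * ((θ : ℂ) * Complex.I)) := by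
      intro θ
      rw [fourier_coe_apply]
      congr 1
      have : (Real.pi : ℂ) ≠ 0 := Complex.ofReal_ne_zero.2 Real.pi_ne_zero
      push_cast
      field_simp
    rcases Int.eq_nat_or_neg n with ⟨m, rfl | rfl⟩
    · refine ⟨fun z => z ^ m, fun _ => 0, by fun_prop, by fun_prop, fun θ => ?_⟩
      simp only [hn, map_zero, add_zero, circlePt]
      rw [← Complex.exp_nat_mul]
      simp
    · refine ⟨fun _ => 0, fun z => z ^ m, by fun_prop, by fun_prop, fun θ => ?_⟩
      simp only [hn, zero_add, circlePt]
      rw [← Complex.exp_nat_mul, ← Complex.exp_conj]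
      congr 1
      simp
  | zero => exact ⟨fun _ => 0, fun _ => 0, by fun_prop, by fun_prop, fun θ => by simp⟩
  | add p q _ _ hp hq =>
    obtain ⟨A, B, hA, hB, h⟩ := hp
    obtain ⟨A', B', hA', hB', h'⟩ := hq
    refine ⟨fun z => A z + A' z, fun z => B z + B' z, hA.add hA', hB.add hB', fun θ => ?_⟩
    rw [ContinuousMap.add_apply, h, h', map_add]; ring
  | smul c p _ hp =>
    obtain ⟨A, B, hA, hB, h⟩ := hp
    refine ⟨fun z => c * A z, fun z => (starRingEnd ℂ) c * B z, hA.const_mul _, hB.const_mul _,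
      fun θ => ?_⟩
    rw [ContinuousMap.smul_apply, h, map_mul, Complex.conj_conj, smul_eq_mul]; ring

lemma exists_entire_re_approx {φ : ℝ → ℝ} {B : ℝ} (hφ : Measurable φ)
    (hper : ∀ θ, φ (θ + 2 * Real.pi) = φ θ) (h0 : ∀ θ, 0 ≤ φ θ) (hB : ∀ θ, φ θ ≤ B)
    {η : ℝ} (hη : 0 < η) :
    ∃ W : ℂ → ℂ, Differentiable ℂ W ∧ (W 0).im = 0 ∧ (∀ θ, 0 ≤ (W (circlePt θ)).re) ∧
      (∀ θ, (W (circlePt θ)).re ≤ B + η) ∧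
      ∫ θ in 0..(2 * Real.pi), |φ θ - (W (circlePt θ)).re| ≤ η := by
  have : Fact (0 < 2 * Real.pi) := ⟨Real.two_pi_pos⟩
  have hpi := Real.pi_pos
  have hB0 : 0 ≤ B := (h0 0).trans (hB 0)
  set k : ℝ → ℝ := fun x => max 0 (min B x) with hk
  have hkc : Continuous k := continuous_const.max (continuous_const.min continuous_id)
  have hkl : ∀ a x, 0 ≤ a → a ≤ B → |a - k x| ≤ |a - x| := by
    intro a x ha ha'
    have e : a = k a := by
      rw [hk]
      simp only
      rw [min_eq_right ha', max_eq_right ha]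
    have h1 : |k a - k x| ≤ |min B a - min B x| := by
      simp only [hk]
      exact (abs_max_sub_max_le_max _ _ _ _).trans (by simp)
    have h2 : |min B a - min B x| ≤ |a - x| :=
      (abs_min_sub_min_le_max _ _ _ _).trans (by simp)
    calc |a - k x| = |k a - k x| := by rw [← e]
      _ ≤ _ := h1.trans h2
  obtain ⟨G, hG1, hG2⟩ := exists_continuous_addCircle_approx (f := fun θ => (φ θ : ℂ)) (B := B)
    (Complex.measurable_ofReal.comp hφ) (fun θ => by rw [hper]) (fun θ => by
      rw [Complex.norm_real, Real.norm_of_nonneg (h0 θ)]; exact hB θ)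
    (p := fun w => (k w.re : ℂ)) (by fun_prop) (fun θ w => by
      rw [← Complex.ofReal_sub, Complex.norm_real, Real.norm_eq_abs]
      refine (hkl _ _ (h0 θ) (hB θ)).trans ?_
      have := Complex.abs_re_le_norm ((φ θ : ℂ) - w)
      rwa [Complex.sub_re, Complex.ofReal_re] at this) (half_pos hη)
  set ρ : ℝ := min (η / 2) (η / 2 / (4 * Real.pi)) with hρ
  have hρ0 : 0 < ρ := by positivity
  have hρ1 : ρ ≤ η / 2 := min_le_left _ _
  have hρ2 : ρ * (4 * Real.pi) ≤ η / 2 := (le_div_iff₀ (by positivity)).1 (min_le_right _ _)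
  have hmem : G ∈ (Submodule.span ℂ (range (@fourier (2 * Real.pi)))).topologicalClosure := by
    rw [span_fourier_closure_eq_top]; trivial
  obtain ⟨p, hp, hpd⟩ := Metric.mem_closure_iff.1
    (show G ∈ closure ((Submodule.span ℂ (range (@fourier (2 * Real.pi))) :
      Submodule ℂ C(AddCircle (2 * Real.pi), ℂ)) : Set C(AddCircle (2 * Real.pi), ℂ)) from hmem) ρ hρ0
  obtain ⟨A, Bf, hA, hBf, hAB⟩ := exists_entire_of_mem_span_fourier hp
  set W : ℂ → ℂ := fun z => A z + Bf z - ((A 0 + Bf 0).im : ℂ) * Complex.I + (ρ : ℂ) with hW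
  have hWre : ∀ θ : ℝ, (W (circlePt θ)).re = (p (θ : AddCircle (2 * Real.pi))).re + ρ := by
    intro θ
    rw [hAB]
    simp [hW]
  have hd : ∀ θ : ℝ, |(G (θ : AddCircle (2 * Real.pi))).re
      - (p (θ : AddCircle (2 * Real.pi))).re| ≤ ρ := by
    intro θ
    rw [← Complex.sub_re]
    refine (Complex.abs_re_le_norm _).trans ?_
    rw [← dist_eq_norm]
    exact (ContinuousMap.dist_apply_le_dist _).trans hpd.le
  have hGre : ∀ θ : ℝ, ∃ w, G (θ : AddCircle (2 * Real.pi)) = ((k w : ℝ) : ℂ) := fun θ => by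
    obtain ⟨w, hw⟩ := hG1 (θ : AddCircle (2 * Real.pi))
    exact ⟨_, hw⟩
  have hG0 : ∀ θ : ℝ, 0 ≤ (G (θ : AddCircle (2 * Real.pi))).re ∧
      (G (θ : AddCircle (2 * Real.pi))).re ≤ B := by
    intro θ
    obtain ⟨w, hw⟩ := hGre θ
    rw [hw, Complex.ofReal_re]
    exact ⟨le_max_left _ _, max_le hB0 (min_le_left _ _)⟩
  refine ⟨W, by fun_prop, ?_, fun θ => ?_, fun θ => ?_, ?_⟩
  · simp [hW]
  · rw [hWre]
    linarith [(abs_le.1 (hd θ)).2, (hG0 θ).1]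
  · rw [hWre]
    linarith [(abs_le.1 (hd θ)).1, (hG0 θ).2]
  · have hGc : Continuous fun θ : ℝ => G (θ : AddCircle (2 * Real.pi)) :=
      G.continuous.comp (AddCircle.continuous_mk' _)
    have hWc : Continuous fun θ : ℝ => (W (circlePt θ)).re := by
      have : Continuous W := Differentiable.continuous (𝕜 := ℂ) (by fun_prop)
      exact Complex.continuous_re.comp (this.comp continuous_circlePt)
    have hφi : IntervalIntegrable φ volume 0 (2 * Real.pi) := by
      rw [intervalIntegrable_iff_integrableOn_Ioc_of_le (by positivity)]
      exact integrableOn_of_bound (B := B) hφ.aestronglyMeasurable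
        (fun θ => by rw [Real.norm_of_nonneg (h0 θ)]; exact hB θ) (by
          rw [Real.volume_Ioc]; exact ENNReal.ofReal_ne_top)
    have hi1 : IntervalIntegrable (fun θ => ‖(φ θ : ℂ) - G (θ : AddCircle (2 * Real.pi))‖) volume 0
        (2 * Real.pi) := by
      refine IntervalIntegrable.norm (IntervalIntegrable.sub ?_ (hGc.intervalIntegrable _ _))
      rw [intervalIntegrable_iff] at hφi ⊢
      exact hφi.ofReal
    have hle : ∫ θ in 0..(2 * Real.pi), |φ θ - (W (circlePt θ)).re| ≤
        ∫ θ in 0..(2 * Real.pi), (‖(φ θ : ℂ) - G (θ : AddCircle (2 * Real.pi))‖ + 2 * ρ) := by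
      refine intervalIntegral.integral_mono_on (by positivity)
        (hφi.sub (hWc.intervalIntegrable _ _)).norm
        (hi1.add (continuous_const.intervalIntegrable _ _)) fun θ _ => ?_
      have h1 := Complex.abs_re_le_norm ((φ θ : ℂ) - G (θ : AddCircle (2 * Real.pi)))
      rw [Complex.sub_re, Complex.ofReal_re] at h1
      rw [hWre]
      have h2 := abs_le.1 (hd θ)
      have h3 := abs_le.1 h1
      rw [abs_le]
      constructor <;> linarith [h2.1, h2.2, h3.1, h3.2]
    rw [intervalIntegral.integral_add hi1 (continuous_const.intervalIntegrable _ _),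
      intervalIntegral.integral_const, smul_eq_mul] at hle
    linarith

lemma re_nonneg_of_circle {W : ℂ → ℂ} (hW : RegularOnClosedDisc W)
    (h : ∀ θ, 0 ≤ (W (circlePt θ)).re) {z : ℂ} (hz : ‖z‖ ≤ 1) : 0 ≤ (W z).re := by
  rcases hz.lt_or_eq with hz | hz
  · rw [← integral_diskPoisson_mul_re hW hz]
    refine mul_nonneg (by positivity) (intervalIntegral.integral_nonneg Real.two_pi_pos.le ?_)
    exact fun θ _ => mul_nonneg (diskPoisson_nonneg hz θ) (h θ)
  · have : z = circlePt z.arg := by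
      conv_lhs => rw [← Complex.norm_mul_exp_arg_mul_I z, hz]
      simp [circlePt]
    rw [this]; exact h _

lemma div_mul_log_le_log {K q B : ℝ} (hK : 0 < K) (hB : 0 < B) (hq : 0 ≤ q) (hqB : q ≤ B) :
    q / B * Real.log (1 + K * B) ≤ Real.log (1 + K * q) := by
  have h1 := rpow_one_add_le_one_add_mul_self (s := K * B)
    (by linarith [mul_pos hK hB]) (div_nonneg hq hB.le) ((div_le_one hB).2 hqB)
  have hp : 0 < 1 + K * B := by positivity
  rw [← Real.log_rpow hp]
  refine Real.log_le_log (Real.rpow_pos_of_pos hp _) (h1.trans_eq ?_)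
  field_simp

lemma uniformContinuous_of_periodic {g : ℝ → ℂ} (hg : Continuous g)
    (hgp : ∀ θ, g (θ + 2 * Real.pi) = g θ) : UniformContinuous g := by
  have : Fact (0 < 2 * Real.pi) := ⟨Real.two_pi_pos⟩
  have hP : Function.Periodic g (2 * Real.pi) := hgp
  have hc : Continuous (hP.lift : AddCircle (2 * Real.pi) → ℂ) := hg.quotient_lift _
  have h1 : UniformContinuous (hP.lift : AddCircle (2 * Real.pi) → ℂ) :=
    CompactSpace.uniformContinuous_of_continuous hc
  have h2 : UniformContinuous (QuotientAddGroup.mk' (AddSubgroup.zmultiples (2 * Real.pi))) :=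
    uniformContinuous_addMonoidHom_of_continuous (AddCircle.continuous_mk' _)
  exact h1.comp h2

/-- A bounded periodic measurable function with its continuous approximation at a given scale. -/
lemma exists_approx_stage {f : ℝ → ℂ} {M : ℝ} (hf : Measurable f)
    (hper : ∀ θ, f (θ + 2 * Real.pi) = f θ) (hM : ∀ θ, ‖f θ‖ ≤ M) {c ε η B N : ℝ} (hc : 0 < c)
    (hε : 0 < ε) (hη : 0 < η) (hB : 0 < B) :
    ∃ (g : ℝ → ℂ) (K δ : ℝ), 0 < K ∧ 0 < δ ∧ δ ≤ η ∧ Continuous g ∧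
      (∀ θ, g (θ + 2 * Real.pi) = g θ) ∧ (∀ θ, ‖g θ‖ ≤ 2 * M) ∧
      ∫ θ in 0..(2 * Real.pi), ‖f θ - g θ‖ ≤ 1 / (2 * K) ∧
      N ≤ c * (ε / (2 * B) * Real.log (1 + K * B)) ∧
      ∀ θ θ', |θ - θ'| < Real.pi * δ → ‖g θ - g θ'‖ ≤ ε := by
  set K : ℝ := Real.exp (N / (c * (ε / (2 * B)))) / B with hK
  have hK0 : 0 < K := by positivity
  obtain ⟨g, hg, hgp, hgb, hgi⟩ := exists_continuous_periodic_approx hf hper hM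
    (η := 1 / (2 * K)) (by positivity)
  have hgu : UniformContinuous g := uniformContinuous_of_periodic hg hgp
  obtain ⟨d, hd, hdg⟩ := Metric.uniformContinuous_iff.1 hgu ε hε
  refine ⟨g, K, min η (d / Real.pi), hK0, by positivity, min_le_left _ _, hg, hgp, hgb, hgi, ?_, ?_⟩
  · have h1 : N / (c * (ε / (2 * B))) ≤ Real.log (1 + K * B) := by
      rw [Real.le_log_iff_exp_le (by positivity), hK, div_mul_cancel₀ _ hB.ne']
      linarith
    rw [div_le_iff₀ (by positivity)] at h1
    linarith
  · intro θ θ' h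
    have h2 : Real.pi * min η (d / Real.pi) ≤ d := by
      calc Real.pi * min η (d / Real.pi) ≤ Real.pi * (d / Real.pi) := by
            gcongr; exact min_le_right _ _
        _ = d := by field_simp
    rw [← dist_eq_norm]
    exact (hdg (by rw [Real.dist_eq]; linarith)).le

/-- A function with small imaginary part whose real part is large on the arcs where the
approximation is bad. -/
lemma exists_barrier {f g : ℝ → ℂ} {M c ε K δ B N : ℝ} (hf : Measurable f)
    (hper : ∀ θ, f (θ + 2 * Real.pi) = f θ) (hM : ∀ θ, ‖f θ‖ ≤ M) (hg : Continuous g)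
    (hgp : ∀ θ, g (θ + 2 * Real.pi) = g θ) (hgM : ∀ θ, ‖g θ‖ ≤ 2 * M) (hc : 0 < c)
    (hε : 0 < ε) (hK : 0 < K) (hδ : 0 < δ) (hB : B = 3 * M + 1)
    (hfg : ∫ θ in 0..(2 * Real.pi), ‖f θ - g θ‖ ≤ 1 / (2 * K))
    (hN : N ≤ c * (ε / (2 * B) * Real.log (1 + K * B))) :
    ∃ H : ℂ → ℂ, RegularOnClosedDisc H ∧ (H 0).im = 0 ∧ (H 0).re ≤ c ∧
      (∀ z, ‖z‖ ≤ 1 → 0 ≤ (H z).re) ∧ (∀ z, ‖z‖ ≤ 1 → |(H z).im| ≤ c * (Real.pi / 2)) ∧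
      ∀ θ₀ t, δ ≤ t → t ≤ 1 → ε < arcMean (fun θ => ‖f θ - g θ‖) θ₀ t →
        N ≤ arcMean (fun θ => (H (circlePt θ)).re) θ₀ t := by
  have hpi := Real.pi_pos
  have hM0 : 0 ≤ M := (norm_nonneg _).trans (hM 0)
  have hB0 : 0 < B := by linarith
  have hφm : Measurable fun θ => ‖f θ - g θ‖ := (hf.sub hg.measurable).norm
  have hφb : ∀ θ, ‖f θ - g θ‖ ≤ 3 * M := fun θ =>
    (norm_sub_le _ _).trans (by linarith [hM θ, hgM θ])
  set η : ℝ := min 1 (min (1 / (2 * K)) (ε * (Real.pi * δ))) with hη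
  have hη0 : 0 < η := by positivity
  have hη1 : η ≤ 1 := min_le_left _ _
  have hη2 : η ≤ 1 / (2 * K) := (min_le_right _ _).trans (min_le_left _ _)
  have hη3 : η ≤ ε * (Real.pi * δ) := (min_le_right _ _).trans (min_le_right _ _)
  obtain ⟨W, hWd, hW0, hWp, hWb, hWi⟩ := exists_entire_re_approx hφm
    (fun θ => by rw [hper, hgp]) (fun θ => norm_nonneg _) hφb hη0
  have hWr : RegularOnClosedDisc W := fun z _ => hWd z
  have hWre : ∀ z, ‖z‖ ≤ 1 → 0 ≤ (W z).re := fun z hz => re_nonneg_of_circle hWr hWp hz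
  have hWc : Continuous fun θ => (W (circlePt θ)).re :=
    Complex.continuous_re.comp (hWd.continuous.comp continuous_circlePt)
  have hφio : ∀ {s : Set ℝ}, volume s ≠ ⊤ → IntegrableOn (fun θ => ‖f θ - g θ‖) s := fun hs =>
    integrableOn_of_bound (B := 3 * M) hφm.aestronglyMeasurable
      (fun θ => by rw [norm_norm]; exact hφb θ) hs
  have hφi : IntervalIntegrable (fun θ => ‖f θ - g θ‖) volume 0 (2 * Real.pi) := by
    rw [intervalIntegrable_iff_integrableOn_Ioc_of_le (by positivity)]
    exact hφio (by rw [Real.volume_Ioc]; exact ENNReal.ofReal_ne_top)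
  have hdi : IntervalIntegrable (fun θ => |‖f θ - g θ‖ - (W (circlePt θ)).re|) volume 0
      (2 * Real.pi) := (hφi.sub (hWc.intervalIntegrable _ _)).norm
  have hKW0 : K * (W 0).re ≤ 1 := by
    have h1 := integral_diskPoisson_mul_re hWr (z := 0) (by simp)
    have h2 : ∀ θ, diskPoisson 0 θ = 1 := fun θ => by simp [diskPoisson, norm_circlePt]
    simp only [h2, one_mul] at h1
    have h3 : ∫ θ in 0..(2 * Real.pi), (W (circlePt θ)).re ≤ ∫ θ in 0..(2 * Real.pi),
        (‖f θ - g θ‖ + |‖f θ - g θ‖ - (W (circlePt θ)).re|) := by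
      refine intervalIntegral.integral_mono_on (by positivity) (hWc.intervalIntegrable _ _)
        (hφi.add hdi) fun θ _ => ?_
      linarith [neg_abs_le (‖f θ - g θ‖ - (W (circlePt θ)).re)]
    rw [intervalIntegral.integral_add hφi hdi] at h3
    have h4 : 1 / (2 * K) + 1 / (2 * K) = 1 / K := by field_simp; norm_num
    have h5 : ∫ θ in 0..(2 * Real.pi), (W (circlePt θ)).re ≤ 1 / K := by linarith
    have h6 : (W 0).re ≤ 1 / K := by
      rw [← h1, inv_mul_le_iff₀ (by positivity)]
      have : 0 < 1 / K := by positivity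
      nlinarith [Real.pi_gt_three]
    rwa [le_div_iff₀' hK] at h6
  have hre : ∀ z, (1 + (K : ℂ) * W z).re = 1 + K * (W z).re := fun z => by simp
  have hsl : ∀ z, ‖z‖ ≤ 1 → 1 + (K : ℂ) * W z ∈ Complex.slitPlane := fun z hz => by
    left
    rw [hre]
    have := mul_nonneg hK.le (hWre z hz)
    linarith
  have hlogre : ∀ z, ‖z‖ ≤ 1 → Real.log (1 + K * (W z).re)
      ≤ (Complex.log (1 + (K : ℂ) * W z)).re := fun z hz => by
    rw [Complex.log_re]
    refine Real.log_le_log ?_ ?_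
    · have := mul_nonneg hK.le (hWre z hz)
      linarith
    · rw [← hre]; exact Complex.re_le_norm _
  set H : ℂ → ℂ := fun z => (c : ℂ) * Complex.log (1 + (K : ℂ) * W z) with hH
  have hHre : ∀ z, ‖z‖ ≤ 1 → c * Real.log (1 + K * (W z).re) ≤ (H z).re := fun z hz => by
    rw [hH]
    simp only [Complex.re_ofReal_mul]
    exact mul_le_mul_of_nonneg_left (hlogre z hz) hc.le
  have hHr : RegularOnClosedDisc H := fun z hz =>
    ((((hWd z).const_mul _).const_add 1).clog (hsl z hz)).const_mul _
  have hW0' : 1 + (K : ℂ) * W 0 = ((1 + K * (W 0).re : ℝ) : ℂ) := by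
    have : W 0 = ((W 0).re : ℂ) := Complex.ext rfl (by simpa using hW0)
    rw [this]; push_cast [Complex.ofReal_re]; ring
  have hW00 : 0 ≤ K * (W 0).re := mul_nonneg hK.le (hWre 0 (by simp))
  have hH0 : H 0 = ((c * Real.log (1 + K * (W 0).re) : ℝ) : ℂ) := by
    simp only [hH]
    rw [hW0', ← Complex.ofReal_log (by linarith)]
    push_cast; ring
  refine ⟨H, hHr, by rw [hH0, Complex.ofReal_im], ?_, fun z hz => ?_, fun z hz => ?_, ?_⟩
  · rw [hH0, Complex.ofReal_re]
    have h1 := Real.log_le_sub_one_of_pos (show 0 < 1 + K * (W 0).re by linarith)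
    nlinarith
  · refine le_trans (mul_nonneg hc.le (Real.log_nonneg ?_)) (hHre z hz)
    have := mul_nonneg hK.le (hWre z hz)
    linarith
  · simp only [hH, Complex.im_ofReal_mul, Complex.log_im, abs_mul, abs_of_pos hc]
    gcongr
    rw [Complex.abs_arg_le_pi_div_two_iff, hre]
    have := mul_nonneg hK.le (hWre z hz)
    linarith
  · intro θ₀ t hδt ht1 hbad
    have ht : 0 < t := hδ.trans_le hδt
    have hio : ∀ {u : ℝ → ℝ}, Continuous u →
        IntegrableOn u (Ioo (θ₀ - Real.pi * t) (θ₀ + Real.pi * t)) := fun hu =>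
      hu.integrableOn_Icc.mono_set Ioo_subset_Icc_self
    have hφA := hφio (volume_arc_ne_top (θ₀ - Real.pi * t) (θ₀ + Real.pi * t))
    have hdA : IntegrableOn (fun θ => |‖f θ - g θ‖ - (W (circlePt θ)).re|)
        (Ioo (θ₀ - Real.pi * t) (θ₀ + Real.pi * t)) := (hφA.sub (hio hWc)).norm
    have h1 : arcMean (fun θ => ‖f θ - g θ‖) θ₀ t ≤ arcMean (fun θ => (W (circlePt θ)).re
        + |‖f θ - g θ‖ - (W (circlePt θ)).re|) θ₀ t :=
      arcMean_mono ht hφA ((hio hWc).add hdA) fun θ _ => by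
        linarith [le_abs_self (‖f θ - g θ‖ - (W (circlePt θ)).re)]
    rw [arcMean_add (hio hWc) hdA] at h1
    have h2 : arcMean (fun θ => |‖f θ - g θ‖ - (W (circlePt θ)).re|) θ₀ t ≤ ε / 2 := by
      have h3 := setIntegral_arc_le
        (u := fun θ => |‖f θ - g θ‖ - (W (circlePt θ)).re|)
        (fun θ => by simp only [hper, hgp, circlePt_add_two_pi]) (fun θ => abs_nonneg _)
        hdi ht1 θ₀
      rw [arcMean, inv_mul_le_iff₀ (by positivity)]
      have h4 : ε * (Real.pi * δ) ≤ ε * (Real.pi * t) := by gcongr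
      linarith
    have h5 : ε / 2 ≤ arcMean (fun θ => (W (circlePt θ)).re) θ₀ t := by linarith
    have hHc : Continuous fun θ => (H (circlePt θ)).re :=
      Complex.continuous_re.comp hHr.continuous_circlePt
    have h6 : arcMean (fun θ => c * (Real.log (1 + K * B) / B) * (W (circlePt θ)).re) θ₀ t ≤
        arcMean (fun θ => (H (circlePt θ)).re) θ₀ t := by
      have hcW : Continuous fun θ => c * (Real.log (1 + K * B) / B) * (W (circlePt θ)).re :=
        continuous_const.mul hWc
      refine arcMean_mono ht (hio hcW) (hio hHc) fun θ _ => ?_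
      refine le_trans ?_ (hHre _ (norm_circlePt θ).le)
      have h7 := div_mul_log_le_log hK hB0 (hWp θ) (by linarith [hWb θ])
      calc _ = c * ((W (circlePt θ)).re / B * Real.log (1 + K * B)) := by ring
        _ ≤ _ := by gcongr
    rw [arcMean_const_mul] at h6
    have hl0 : 0 ≤ Real.log (1 + K * B) := Real.log_nonneg (by nlinarith)
    calc N ≤ c * (ε / (2 * B) * Real.log (1 + K * B)) := hN
      _ = c * (Real.log (1 + K * B) / B) * (ε / 2) := by field_simp
      _ ≤ _ := mul_le_mul_of_nonneg_left h5 (by positivity)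
      _ ≤ _ := h6

lemma ae_summable_norm_and_integrable_tsum {α E : Type*} {_ : MeasurableSpace α} {μ : Measure α}
    [NormedAddCommGroup E] [CompleteSpace E] {F : ℕ → α → E} (hF : ∀ n, Integrable (F n) μ)
    (hs : Summable fun n => ∫ a, ‖F n a‖ ∂μ) :
    (∀ᵐ a ∂μ, Summable fun n => ‖F n a‖) ∧ Integrable (fun a => ∑' n, F n a) μ := by
  have hfin : ∑' n, ∫⁻ a, ‖F n a‖ₑ ∂μ ≠ ⊤ := by
    have : ∀ n, ∫⁻ a, ‖F n a‖ₑ ∂μ = ENNReal.ofReal (∫ a, ‖F n a‖ ∂μ) := fun n =>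
      (ofReal_integral_norm_eq_lintegral_enorm (hF n)).symm
    simp only [this]
    exact hs.tsum_ofReal_ne_top
  have hae : ∀ᵐ a ∂μ, Summable fun n => ‖F n a‖ := by
    refine summable_norm_of_tsum_eLpNorm_ne_top (p := 1) le_rfl (fun n => (hF n).1) ?_
    simpa only [eLpNorm_one_eq_lintegral_enorm] using hfin
  refine ⟨hae, ?_, ?_⟩
  · refine aestronglyMeasurable_of_tendsto_ae atTop
      (f := fun N a => ∑ n ∈ Finset.range N, F n a)
      (fun N => (integrable_finsetSum _ fun n _ => hF n).1) ?_
    filter_upwards [hae] with a ha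
    exact ha.of_norm.hasSum.tendsto_sum_nat
  · refine lt_of_le_of_lt (lintegral_mono fun a => enorm_tsum_le_tsum_enorm) ?_
    rw [lintegral_tsum fun n => (hF n).1.enorm]
    exact hfin.lt_top

/-- A sequence of functions with nonnegative real parts, regular on the closed disc, whose values
at the origin and whose imaginary parts decay geometrically. -/
structure BarrierSeq (H : ℕ → ℂ → ℂ) : Prop where
  regular : ∀ n, RegularOnClosedDisc (H n)
  im_zero : ∀ n, (H n 0).im = 0
  re_zero_le : ∀ n, (H n 0).re ≤ (1 / 2) ^ n
  re_nonneg : ∀ n z, ‖z‖ ≤ 1 → 0 ≤ (H n z).re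
  abs_im_le : ∀ n z, ‖z‖ ≤ 1 → |(H n z).im| ≤ (1 / 2) ^ n * (Real.pi / 2)

/-- The partial sums of a sequence of functions. -/
def partialSum (H : ℕ → ℂ → ℂ) (N : ℕ) (z : ℂ) : ℂ := ∑ n ∈ Finset.range N, H n z

/-- The boundary function of the exponential of minus the sum of a sequence of functions. -/
def expBoundary (H : ℕ → ℂ → ℂ) (θ : ℝ) : ℂ := Complex.exp (-∑' n, H n (circlePt θ))

/-- The logarithm of the modulus of `expBoundary`, extended to the plane. -/
def logModulus (H : ℕ → ℂ → ℂ) (z : ℂ) : ℝ := -∑' n, (H n z).re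

/-- The outer function with boundary modulus `exp (logModulus H)`. -/
def outerExp (H : ℕ → ℂ → ℂ) (z : ℂ) : ℂ :=
  Complex.exp (((2 * Real.pi)⁻¹ : ℝ) • ∫ θ in Set.Ioc 0 (2 * Real.pi),
      ((circlePt θ + z) / (circlePt θ - z)) * (logModulus H (circlePt θ) : ℂ))

namespace BarrierSeq

variable {H : ℕ → ℂ → ℂ}

lemma integral_norm_le (hH : BarrierSeq H) (n : ℕ) :
    ∫ θ in Ioc 0 (2 * Real.pi), ‖H n (circlePt θ)‖
      ≤ (1 / 2) ^ n * (2 * Real.pi + 2 * Real.pi * (Real.pi / 2)) := by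
  have hpi := Real.pi_pos
  have hc := (hH.regular n).continuous_circlePt
  have hr : Continuous fun θ => (H n (circlePt θ)).re := Complex.continuous_re.comp hc
  have h1 := integral_diskPoisson_mul_re (hH.regular n) (z := 0) (by simp)
  have h2 : ∀ θ, diskPoisson 0 θ = 1 := fun θ => by simp [diskPoisson, norm_circlePt]
  simp only [h2, one_mul] at h1
  rw [inv_mul_eq_iff_eq_mul₀ (by positivity)] at h1
  rw [← intervalIntegral.integral_of_le (by positivity)]
  have h3 : ∫ θ in 0..(2 * Real.pi), ‖H n (circlePt θ)‖ ≤
      ∫ θ in 0..(2 * Real.pi), ((H n (circlePt θ)).re + (1 / 2) ^ n * (Real.pi / 2)) := by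
    refine intervalIntegral.integral_mono_on (by positivity) (hc.norm.intervalIntegrable _ _)
      ((hr.add continuous_const).intervalIntegrable _ _) fun θ _ => ?_
    have hθ := (norm_circlePt θ).le
    have := Complex.norm_le_abs_re_add_abs_im (H n (circlePt θ))
    rw [abs_of_nonneg (hH.re_nonneg n _ hθ)] at this
    linarith [hH.abs_im_le n _ hθ]
  rw [intervalIntegral.integral_add (hr.intervalIntegrable _ _)
    (continuous_const.intervalIntegrable _ _), h1, intervalIntegral.integral_const, smul_eq_mul,
    sub_zero] at h3
  have := mul_le_mul_of_nonneg_left (hH.re_zero_le n) Real.two_pi_pos.le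
  linarith

lemma summable_integral_norm (hH : BarrierSeq H) :
    Summable fun n => ∫ θ in Ioc 0 (2 * Real.pi), ‖H n (circlePt θ)‖ :=
  Summable.of_nonneg_of_le (fun _ => integral_nonneg fun _ => norm_nonneg _)
    hH.integral_norm_le (summable_geometric_two.mul_right _)

lemma integrableOn (hH : BarrierSeq H) (n : ℕ) :
    IntegrableOn (fun θ => H n (circlePt θ)) (Ioc 0 (2 * Real.pi)) :=
  (hH.regular n).continuous_circlePt.integrableOn_Ioc

lemma ae_summable_norm (hH : BarrierSeq H) :
    ∀ᵐ θ, Summable fun n => ‖H n (circlePt θ)‖ :=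
  ae_of_ae_restrict_periodic (fun θ => by simp only [circlePt_add_two_pi])
    (ae_summable_norm_and_integrable_tsum hH.integrableOn hH.summable_integral_norm).1

lemma regular_partialSum (hH : BarrierSeq H) (N : ℕ) : RegularOnClosedDisc (partialSum H N) :=
  fun z hz => DifferentiableAt.fun_sum fun n _ => hH.regular n z hz

lemma re_partialSum_nonneg (hH : BarrierSeq H) (N : ℕ) {z : ℂ} (hz : ‖z‖ ≤ 1) :
    0 ≤ (partialSum H N z).re := by
  rw [partialSum, Complex.re_sum]
  exact Finset.sum_nonneg fun n _ => hH.re_nonneg n z hz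

lemma norm_exp_neg_partialSum_le (hH : BarrierSeq H) (N : ℕ) {z : ℂ} (hz : ‖z‖ ≤ 1) :
    ‖Complex.exp (-partialSum H N z)‖ ≤ 1 := by
  rw [Complex.norm_exp, Real.exp_le_one_iff, Complex.neg_re]
  linarith [hH.re_partialSum_nonneg N hz]

lemma ae_tendsto_exp_partialSum (hH : BarrierSeq H) :
    ∀ᵐ θ, Tendsto (fun N => Complex.exp (-partialSum H N (circlePt θ))) atTop
      (𝓝 (expBoundary H θ)) := by
  filter_upwards [hH.ae_summable_norm] with θ h
  exact (Complex.continuous_exp.tendsto _).comp h.of_norm.hasSum.tendsto_sum_nat.neg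

lemma expBoundary_periodic (H : ℕ → ℂ → ℂ) (θ : ℝ) :
    expBoundary H (θ + 2 * Real.pi) = expBoundary H θ := by
  simp only [expBoundary, circlePt_add_two_pi]

lemma norm_expBoundary_le (hH : BarrierSeq H) (θ : ℝ) : ‖expBoundary H θ‖ ≤ 1 := by
  rw [expBoundary, Complex.norm_exp, Real.exp_le_one_iff, Complex.neg_re, neg_nonpos]
  by_cases h : Summable fun n => H n (circlePt θ)
  · rw [Complex.re_tsum h]
    exact tsum_nonneg fun n => hH.re_nonneg n _ (norm_circlePt θ).le
  · rw [tsum_eq_zero_of_not_summable h, Complex.zero_re]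

lemma continuous_exp_partialSum (hH : BarrierSeq H) (N : ℕ) :
    Continuous fun θ => Complex.exp (-partialSum H N (circlePt θ)) :=
  Complex.continuous_exp.comp (hH.regular_partialSum N).continuous_circlePt.neg

lemma aestronglyMeasurable_expBoundary (hH : BarrierSeq H) :
    AEStronglyMeasurable (expBoundary H) :=
  aestronglyMeasurable_of_tendsto_ae atTop
    (fun N => (hH.continuous_exp_partialSum N).aestronglyMeasurable) hH.ae_tendsto_exp_partialSum

lemma integrableOn_re (hH : BarrierSeq H) (n : ℕ) :
    IntegrableOn (fun θ => (H n (circlePt θ)).re) (Ioc 0 (2 * Real.pi)) :=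
  (hH.integrableOn n).re

lemma summable_integral_norm_re (hH : BarrierSeq H) :
    Summable fun n => ∫ θ in Ioc 0 (2 * Real.pi), ‖(H n (circlePt θ)).re‖ :=
  Summable.of_nonneg_of_le (fun _ => integral_nonneg fun _ => norm_nonneg _)
    (fun n => integral_mono (hH.integrableOn_re n).norm (hH.integrableOn n).norm
      fun _ => Complex.abs_re_le_norm _) hH.summable_integral_norm

lemma integrableOn_logModulus (hH : BarrierSeq H) :
    IntegrableOn (fun θ => logModulus H (circlePt θ)) (Ioc 0 (2 * Real.pi)) :=
  (ae_summable_norm_and_integrable_tsum hH.integrableOn_re hH.summable_integral_norm_re).2.neg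

lemma differentiableOn_outerExp (hH : BarrierSeq H) :
    DifferentiableOn ℂ (outerExp H) unitDisc := by
  have hci : CircleIntegrable (fun z => (logModulus H z : ℂ)) 0 1 := by
    rw [CircleIntegrable, intervalIntegrable_iff_integrableOn_Ioc_of_le Real.two_pi_pos.le]
    have h := hH.integrableOn_logModulus.ofReal (𝕜 := ℂ)
    simp only [circlePt_eq_circleMap] at h
    exact h
  have hd := (differentiableOn_circleAverage_herglotzRieszKernel_smul hci).cexp
  have hball : unitDisc = Metric.ball (0 : ℂ) 1 := by
    ext z; simp [unitDisc]
  rw [hball]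
  refine hd.congr fun z _ => ?_
  rw [outerExp, Real.circleAverage_def, intervalIntegral.integral_of_le Real.two_pi_pos.le]
  simp [herglotzRieszKernel, circlePt_eq_circleMap]

lemma isOuter (hH : BarrierSeq H) : IsOuter (outerExp H) :=
  ⟨hH.differentiableOn_outerExp, _, hH.integrableOn_logModulus, fun _ _ => rfl⟩

lemma tendsto_exp_partialSum (hH : BarrierSeq H) {z : ℂ} (hz : ‖z‖ < 1) :
    Tendsto (fun N => Complex.exp (-partialSum H N z)) atTop (𝓝 (outerExp H z)) := by
  set k : ℝ → ℂ := fun θ => (circlePt θ + z) / (circlePt θ - z) with hk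
  have hkc : Continuous k :=
    (continuous_circlePt.add continuous_const).div (continuous_circlePt.sub continuous_const)
      (circlePt_sub_ne_zero hz)
  obtain ⟨C, hC⟩ : ∃ C, ∀ θ ∈ Icc 0 (2 * Real.pi), ‖k θ‖ ≤ C :=
    isCompact_Icc.exists_bound_of_continuousOn hkc.continuousOn
  have hrc : ∀ n, Continuous fun θ => ((H n (circlePt θ)).re : ℂ) := fun n =>
    Complex.continuous_ofReal.comp
      (Complex.continuous_re.comp (hH.regular n).continuous_circlePt)
  have hFc : ∀ n, Continuous fun θ => k θ * ((H n (circlePt θ)).re : ℂ) := fun n =>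
    hkc.mul (hrc n)
  have hs := hasSum_integral_of_summable_integral_norm
    (F := fun n θ => k θ * ((H n (circlePt θ)).re : ℂ)) (μ := volume.restrict (Ioc 0 (2 * Real.pi)))
    (fun n => (hFc n).integrableOn_Ioc) (by
      refine Summable.of_nonneg_of_le (fun _ => integral_nonneg fun _ => norm_nonneg _)
        (fun n => ?_) (hH.summable_integral_norm_re.mul_left C)
      rw [← integral_const_mul]
      refine setIntegral_mono_on ((hFc n).integrableOn_Ioc.norm)
        ((hH.integrableOn_re n).norm.const_mul C) measurableSet_Ioc fun θ hθ => ?_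
      rw [norm_mul, Complex.norm_real]
      exact mul_le_mul_of_nonneg_right (hC θ (Ioc_subset_Icc_self hθ)) (norm_nonneg _))
  have hs2 := hs.const_smul ((2 * Real.pi)⁻¹ : ℝ)
  have e1 : ∀ n, ((2 * Real.pi)⁻¹ : ℝ) • ∫ θ in Ioc 0 (2 * Real.pi),
      k θ * ((H n (circlePt θ)).re : ℂ) = H n z := fun n => by
    rw [← intervalIntegral.integral_of_le Real.two_pi_pos.le]
    exact integral_herglotz_re (hH.regular n) (hH.im_zero n) hz
  simp only [e1] at hs2
  have e2 : ∀ θ, ∑' n, k θ * ((H n (circlePt θ)).re : ℂ)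
      = -(k θ * (logModulus H (circlePt θ) : ℂ)) := fun θ => by
    rw [tsum_mul_left, logModulus, ← Complex.ofReal_tsum]
    push_cast; ring
  simp only [e2, integral_neg, smul_neg] at hs2
  have h3 := hs2.tendsto_sum_nat.neg
  rw [neg_neg] at h3
  exact (Complex.continuous_exp.tendsto _).comp h3

lemma outerExp_eq_integral (hH : BarrierSeq H) {z : ℂ} (hz : ‖z‖ < 1) :
    outerExp H z = ((2 * Real.pi)⁻¹ : ℝ) • ∫ θ in 0..(2 * Real.pi),
      (diskPoisson z θ : ℂ) * expBoundary H θ := by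
  have hPc : Continuous fun θ => (diskPoisson z θ : ℂ) :=
    Complex.continuous_ofReal.comp (continuous_diskPoisson hz)
  have h1 : ∀ N, ((2 * Real.pi)⁻¹ : ℝ) • ∫ θ in 0..(2 * Real.pi),
      (diskPoisson z θ : ℂ) * Complex.exp (-partialSum H N (circlePt θ))
        = Complex.exp (-partialSum H N z) := fun N =>
    integral_diskPoisson_mul (F := fun z => Complex.exp (-partialSum H N z))
      (fun w hw => (hH.regular_partialSum N w hw).neg.cexp) hz
  refine tendsto_nhds_unique (hH.tendsto_exp_partialSum hz) ?_
  simp only [← h1]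
  refine Tendsto.const_smul ?_ _
  refine intervalIntegral.tendsto_integral_filter_of_dominated_convergence (diskPoisson z)
    (Eventually.of_forall fun N =>
      (hPc.mul (hH.continuous_exp_partialSum N)).aestronglyMeasurable)
    (Eventually.of_forall fun N => ae_of_all _ fun θ _ => ?_)
    ((continuous_diskPoisson hz).intervalIntegrable _ _) ?_
  · rw [norm_mul, Complex.norm_real, Real.norm_of_nonneg (diskPoisson_nonneg hz θ)]
    exact mul_le_of_le_one_right (diskPoisson_nonneg hz θ)
      (hH.norm_exp_neg_partialSum_le N (norm_circlePt θ).le)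
  · filter_upwards [hH.ae_tendsto_exp_partialSum] with θ h _
    exact h.const_mul _

lemma hasRadialLimits (hH : BarrierSeq H) : HasRadialLimits (outerExp H) (expBoundary H) :=
  hasRadialLimits_of_poisson hH.aestronglyMeasurable_expBoundary hH.norm_expBoundary_le
    (expBoundary_periodic H) fun _ hz => hH.outerExp_eq_integral hz

lemma memHinf (hH : BarrierSeq H) : MemHinf (outerExp H) :=
  ⟨hH.differentiableOn_outerExp, 1, fun _ hz => le_of_tendsto
    (hH.tendsto_exp_partialSum hz).norm
    (Eventually.of_forall fun N => hH.norm_exp_neg_partialSum_le N (le_of_lt hz))⟩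

end BarrierSeq

lemma norm_exp_neg_sub_exp_neg_le {x a : ℂ} (hx : 0 ≤ x.re) (ha : 0 ≤ a.re) :
    ‖Complex.exp (-x) - Complex.exp (-a)‖ ≤ ‖x - a‖ := by
  have h := (convex_halfSpace_re_ge (0 : ℝ)).norm_image_sub_le_of_norm_hasDerivWithin_le
    (f := fun z : ℂ => Complex.exp (-z)) (f' := fun z => Complex.exp (-z) * -1) (C := 1)
    (x := a) (y := x) (fun z _ => ((hasDerivAt_neg z).cexp).hasDerivWithinAt)
    (fun z hz => by
      rw [mul_neg_one, norm_neg, Complex.norm_exp, Real.exp_le_one_iff, Complex.neg_re]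
      exact neg_nonpos.2 hz) ha hx
  simpa using h

lemma abs_sub_lt_of_mem_arc {θ₀ θ r : ℝ} (h : θ ∈ Ioo (θ₀ - r) (θ₀ + r)) : |θ - θ₀| < r :=
  abs_lt.2 ⟨by linarith [h.1], by linarith [h.2]⟩

lemma Continuous.integrableOn_arc {E : Type*} [NormedAddCommGroup E] {u : ℝ → E}
    (hu : Continuous u) (a b : ℝ) : IntegrableOn u (Ioo a b) :=
  (hu.integrableOn_Icc (a := a) (b := b)).mono_set Ioo_subset_Icc_self

namespace BarrierSeq

variable {H : ℕ → ℂ → ℂ}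

lemma partialSum_add (H : ℕ → ℂ → ℂ) (N k : ℕ) (z : ℂ) :
    partialSum H (N + k) z = partialSum H N z + partialSum (fun n => H (N + n)) k z :=
  Finset.sum_range_add _ _ _

lemma abs_im_tail_le (hH : BarrierSeq H) (N k : ℕ) {z : ℂ} (hz : ‖z‖ ≤ 1) :
    |(partialSum (fun n => H (N + n)) k z).im| ≤ (1 / 2) ^ N * Real.pi := by
  rw [partialSum, Complex.im_sum]
  calc |∑ n ∈ Finset.range k, (H (N + n) z).im|
      ≤ ∑ n ∈ Finset.range k, (1 / 2) ^ N * (Real.pi / 2) * (1 / 2 : ℝ) ^ n :=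
        (Finset.abs_sum_le_sum_abs _ _).trans (Finset.sum_le_sum fun n _ => by
          refine (hH.abs_im_le _ z hz).trans_eq ?_
          rw [pow_add]; ring)
    _ ≤ (1 / 2) ^ N * (Real.pi / 2) * 2 := by
        rw [← Finset.mul_sum]
        refine mul_le_mul_of_nonneg_left ?_ (by positivity)
        exact (summable_geometric_two.sum_le_tsum _ fun n _ => by positivity).trans_eq
          tsum_geometric_two
    _ = _ := by ring

lemma re_tail_nonneg (hH : BarrierSeq H) (N k : ℕ) {z : ℂ} (hz : ‖z‖ ≤ 1) :
    0 ≤ (partialSum (fun n => H (N + n)) k z).re := by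
  rw [partialSum, Complex.re_sum]
  exact Finset.sum_nonneg fun n _ => hH.re_nonneg _ z hz

/-- The partial sums have small oscillation on short arcs, eventually uniformly. -/
lemma exists_arcMean_partialSum_le (hH : BarrierSeq H) {η : ℝ} (hη : 0 < η) :
    ∃ δ : ℝ, 0 < δ ∧ δ ≤ 1 ∧ ∃ N : ℕ, ∀ θ₀ t : ℝ, 0 < t → t < δ → ∀ m ≥ N, ∃ a : ℂ, 0 ≤ a.re ∧
      arcMean (fun θ => ‖partialSum H m (circlePt θ) - a‖) θ₀ t ≤ η := by
  have hpi := Real.pi_pos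
  obtain ⟨N, hN⟩ := exists_pow_lt_of_lt_one (show 0 < η / (16 * Real.pi) by positivity)
    (show (1 / 2 : ℝ) < 1 by norm_num)
  rw [lt_div_iff₀ (by positivity)] at hN
  have hreg := hH.regular_partialSum N
  have huc := uniformContinuous_of_periodic hreg.continuous_circlePt
    (fun θ => by simp only [circlePt_add_two_pi])
  obtain ⟨d, hd, hd'⟩ := Metric.uniformContinuous_iff.1 huc (η / 2) (by positivity)
  refine ⟨min 1 (d / Real.pi), by positivity, min_le_left _ _, N, fun θ₀ t ht htδ m hm => ?_⟩
  obtain ⟨k, rfl⟩ := Nat.exists_eq_add_of_le hm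
  have ht1 : t ≤ 1 := (htδ.trans_le (min_le_left _ _)).le
  have htd : Real.pi * t < d := by
    have := htδ.trans_le (min_le_right _ _)
    rwa [lt_div_iff₀ hpi, mul_comm] at this
  set R : ℂ → ℂ := partialSum (fun n => H (N + n)) k with hR
  have hRreg : RegularOnClosedDisc R := fun z hz =>
    DifferentiableAt.fun_sum fun n _ => hH.regular _ z hz
  have hz := norm_arcPt_lt θ₀ ht ht1
  refine ⟨partialSum H N (circlePt θ₀) + R (arcPt θ₀ t), ?_, ?_⟩
  · rw [Complex.add_re]
    exact add_nonneg (hH.re_partialSum_nonneg N (norm_circlePt θ₀).le)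
      (hH.re_tail_nonneg N k hz.le)
  have h1 := arcMean_norm_sub_le hRreg (τ := (1 / 2) ^ N * Real.pi) (by positivity)
    (fun θ => hH.abs_im_tail_le N k (norm_circlePt θ).le) θ₀ ht ht1
  have hRc := hRreg.continuous_circlePt
  have hSc := hreg.continuous_circlePt
  have hRi : Continuous fun θ => ‖R (circlePt θ) - R (arcPt θ₀ t)‖ :=
    (hRc.sub continuous_const).norm
  have h2 : arcMean (fun θ => ‖partialSum H (N + k) (circlePt θ)
      - (partialSum H N (circlePt θ₀) + R (arcPt θ₀ t))‖) θ₀ t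
      ≤ arcMean (fun θ => ‖R (circlePt θ) - R (arcPt θ₀ t)‖ + η / 2) θ₀ t := by
    refine arcMean_mono ht
      (((hH.regular_partialSum _).continuous_circlePt.sub continuous_const).norm.integrableOn_arc
        _ _) ((hRi.add continuous_const).integrableOn_arc _ _) fun θ hθ => ?_
    have h3 := hd' ((Real.dist_eq θ θ₀).trans_lt ((abs_sub_lt_of_mem_arc hθ).trans htd))
    rw [dist_eq_norm] at h3
    rw [partialSum_add, ← hR]
    calc _ = ‖(R (circlePt θ) - R (arcPt θ₀ t))
          + (partialSum H N (circlePt θ) - partialSum H N (circlePt θ₀))‖ := by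
            congr 1; ring
      _ ≤ _ := (norm_add_le _ _).trans (by linarith)
  rw [arcMean_add (hRi.integrableOn_arc _ _) (integrableOn_const_arc _ _ _),
    arcMean_const _ _ ht] at h2
  linarith

lemma arcMean_re_le_of_lt (hH : BarrierSeq H) {θ₀ t η : ℝ} (ht : 0 < t) {n m : ℕ} (hnm : n < m)
    {a : ℂ} (ha : arcMean (fun θ => ‖partialSum H m (circlePt θ) - a‖) θ₀ t ≤ η) :
    arcMean (fun θ => (H n (circlePt θ)).re) θ₀ t ≤ a.re + η := by
  have hc : Continuous fun θ => ‖partialSum H m (circlePt θ) - a‖ :=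
    ((hH.regular_partialSum m).continuous_circlePt.sub continuous_const).norm
  have h : arcMean (fun θ => (H n (circlePt θ)).re) θ₀ t
      ≤ arcMean (fun θ => a.re + ‖partialSum H m (circlePt θ) - a‖) θ₀ t := by
    refine arcMean_mono ht
      ((Complex.continuous_re.comp (hH.regular n).continuous_circlePt).integrableOn_arc _ _)
      ((continuous_const.add hc).integrableOn_arc _ _) fun θ _ => ?_
    have h1 : (H n (circlePt θ)).re ≤ (partialSum H m (circlePt θ)).re := by
      rw [partialSum, Complex.re_sum]
      exact Finset.single_le_sum (f := fun i => (H i (circlePt θ)).re)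
        (fun i _ => hH.re_nonneg i _ (norm_circlePt θ).le) (Finset.mem_range.2 hnm)
    have h2 := Complex.re_le_norm (partialSum H m (circlePt θ) - a)
    rw [Complex.sub_re] at h2
    linarith
  rw [arcMean_add (integrableOn_const_arc _ _ _) (hc.integrableOn_arc _ _),
    arcMean_const _ _ ht] at h
  linarith

lemma isVMO_expBoundary (hH : BarrierSeq H) : IsVMO (expBoundary H) := by
  refine isVMO_of_tendsto (B := 1)
    (fun m => (hH.continuous_exp_partialSum m).aestronglyMeasurable)
    (fun m θ => hH.norm_exp_neg_partialSum_le m (norm_circlePt θ).le)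
    hH.ae_tendsto_exp_partialSum (expBoundary_periodic H) fun ε hε => ?_
  obtain ⟨δ, hδ, -, N, h⟩ := hH.exists_arcMean_partialSum_le (half_pos hε)
  refine ⟨δ, hδ, fun θ₀ t ht htδ => ?_⟩
  filter_upwards [eventually_ge_atTop N] with m hm
  obtain ⟨a, ha, hma⟩ := h θ₀ t ht htδ m hm
  have hc := hH.continuous_exp_partialSum m
  have h1 := meanOsc_le_two_mul (θ₀ := θ₀) (Complex.exp (-a)) ht (hc.integrableOn_arc _ _)
  have h2 : arcMean (fun θ => ‖Complex.exp (-partialSum H m (circlePt θ)) - Complex.exp (-a)‖) θ₀ t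
      ≤ arcMean (fun θ => ‖partialSum H m (circlePt θ) - a‖) θ₀ t :=
    arcMean_mono ht ((hc.sub continuous_const).norm.integrableOn_arc _ _)
      (((hH.regular_partialSum m).continuous_circlePt.sub continuous_const).norm.integrableOn_arc
        _ _)
      fun θ _ => norm_exp_neg_sub_exp_neg_le (hH.re_partialSum_nonneg m (norm_circlePt θ).le) ha
  linarith

/-- If on every sufficiently short arc either `f` is close in mean to a constant or some barrier is
large in mean, then multiplication by `expBoundary H` takes `f` to `VMO`. -/
lemma isVMO_expBoundary_mul (hH : BarrierSeq H) {f : ℝ → ℂ} {M : ℝ} (hf : Measurable f)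
    (hper : ∀ θ, f (θ + 2 * Real.pi) = f θ) (hM : ∀ θ, ‖f θ‖ ≤ M)
    (halt : ∀ ε > 0, ∀ A : ℝ, ∃ δ > 0, ∀ θ₀ t : ℝ, 0 < t → t < δ →
      (∃ w : ℂ, arcMean (fun θ => ‖f θ - w‖) θ₀ t ≤ ε) ∨
        ∃ n, A ≤ arcMean (fun θ => (H n (circlePt θ)).re) θ₀ t) :
    IsVMO (fun θ => expBoundary H θ * f θ) := by
  have hM0 : 0 ≤ M := (norm_nonneg _).trans (hM 0)
  have hmeas : ∀ m, AEStronglyMeasurable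
      (fun θ => Complex.exp (-partialSum H m (circlePt θ)) * f θ) := fun m =>
    (hH.continuous_exp_partialSum m).aestronglyMeasurable.mul hf.aestronglyMeasurable
  have hbd : ∀ m θ, ‖Complex.exp (-partialSum H m (circlePt θ)) * f θ‖ ≤ M := fun m θ => by
    rw [norm_mul]
    exact (mul_le_of_le_one_left (norm_nonneg _)
      (hH.norm_exp_neg_partialSum_le m (norm_circlePt θ).le)).trans (hM θ)
  refine isVMO_of_tendsto (B := M) hmeas hbd ?_
    (fun θ => by rw [expBoundary_periodic, hper]) fun ε hε => ?_
  · filter_upwards [hH.ae_tendsto_exp_partialSum] with θ h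
    exact h.mul_const _
  have hη : 0 < ε / (4 * (M + 1)) := by positivity
  set η := ε / (4 * (M + 1)) with hηdef
  have hηM : M * η ≤ ε / 4 := by
    rw [hηdef, mul_div_assoc', div_le_div_iff₀ (by positivity) (by norm_num)]
    nlinarith
  obtain ⟨δ₁, hδ₁, -, N, hN⟩ := hH.exists_arcMean_partialSum_le hη
  obtain ⟨δ₂, hδ₂, h2⟩ := halt (ε / 4) (by positivity) (η - Real.log η)
  refine ⟨min δ₁ δ₂, lt_min hδ₁ hδ₂, fun θ₀ t ht htδ => ?_⟩
  have hfi : ∀ w : ℂ, IntegrableOn (fun θ => ‖f θ - w‖)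
      (Ioo (θ₀ - Real.pi * t) (θ₀ + Real.pi * t)) := fun w =>
    ((integrableOn_of_bound hf.aestronglyMeasurable hM (volume_arc_ne_top _ _)).sub
      (integrableOn_const_arc w θ₀ t)).norm
  have hFi : ∀ m, IntegrableOn (fun θ => Complex.exp (-partialSum H m (circlePt θ)) * f θ)
      (Ioo (θ₀ - Real.pi * t) (θ₀ + Real.pi * t)) := fun m =>
    integrableOn_of_bound (hmeas m) (hbd m) (volume_arc_ne_top _ _)
  have hSi : ∀ m (a : ℂ), IntegrableOn (fun θ => ‖partialSum H m (circlePt θ) - a‖)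
      (Ioo (θ₀ - Real.pi * t) (θ₀ + Real.pi * t)) := fun m a =>
    ((hH.regular_partialSum m).continuous_circlePt.sub continuous_const).norm.integrableOn_arc _ _
  have key : ∀ m (a w : ℂ), 0 ≤ a.re →
      arcMean (fun θ => ‖partialSum H m (circlePt θ) - a‖) θ₀ t ≤ η →
      meanOsc (fun θ => Complex.exp (-partialSum H m (circlePt θ)) * f θ) θ₀ t
        ≤ 2 * (M * η + ‖Complex.exp (-a)‖ * arcMean (fun θ => ‖f θ - w‖) θ₀ t) := by
    intro m a w ha hma
    refine (meanOsc_le_two_mul (Complex.exp (-a) * w) ht (hFi m)).trans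
      (mul_le_mul_of_nonneg_left ?_ zero_le_two)
    refine (arcMean_mono ht ((hFi m).sub (integrableOn_const_arc _ θ₀ t)).norm
      (((hSi m a).const_mul M).add ((hfi w).const_mul ‖Complex.exp (-a)‖)) fun θ _ => ?_).trans ?_
    · have h := norm_exp_neg_sub_exp_neg_le (hH.re_partialSum_nonneg m (norm_circlePt θ).le) ha
      calc ‖Complex.exp (-partialSum H m (circlePt θ)) * f θ - Complex.exp (-a) * w‖
          = ‖f θ * (Complex.exp (-partialSum H m (circlePt θ)) - Complex.exp (-a))
            + Complex.exp (-a) * (f θ - w)‖ := by congr 1; ring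
        _ ≤ M * ‖partialSum H m (circlePt θ) - a‖ + ‖Complex.exp (-a)‖ * ‖f θ - w‖ := by
            refine (norm_add_le _ _).trans ?_
            rw [norm_mul, norm_mul]
            gcongr
            exact hM θ
    · refine (arcMean_add ((hSi m a).const_mul M) ((hfi w).const_mul _)).trans_le ?_
      rw [arcMean_const_mul, arcMean_const_mul]
      gcongr
  rcases h2 θ₀ t ht (htδ.trans_le (min_le_right _ _)) with ⟨w, hw⟩ | ⟨n, hn⟩
  · filter_upwards [eventually_ge_atTop N] with m hm
    obtain ⟨a, ha, hma⟩ := hN θ₀ t ht (htδ.trans_le (min_le_left _ _)) m hm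
    have h3 := key m a w ha hma
    have h4 : ‖Complex.exp (-a)‖ ≤ 1 := by
      rw [Complex.norm_exp, Real.exp_le_one_iff, Complex.neg_re]; linarith
    have h5 : ‖Complex.exp (-a)‖ * arcMean (fun θ => ‖f θ - w‖) θ₀ t ≤ 1 * (ε / 4) :=
      (mul_le_mul_of_nonneg_left hw (norm_nonneg _)).trans
        (mul_le_mul_of_nonneg_right h4 (by positivity))
    linarith
  · filter_upwards [eventually_ge_atTop N, eventually_gt_atTop n] with m hm hnm
    obtain ⟨a, ha, hma⟩ := hN θ₀ t ht (htδ.trans_le (min_le_left _ _)) m hm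
    have h3 := key m a 0 ha hma
    have h4 : ‖Complex.exp (-a)‖ ≤ η := by
      rw [Complex.norm_exp, ← Real.le_log_iff_exp_le hη, Complex.neg_re]
      linarith [hH.arcMean_re_le_of_lt ht hnm hma]
    have h5 : arcMean (fun θ => ‖f θ - 0‖) θ₀ t ≤ M :=
      (arcMean_mono ht (hfi 0) (integrableOn_const_arc M θ₀ t)
        fun θ _ => by simpa using hM θ).trans_eq (arcMean_const _ _ ht)
    have h6 : ‖Complex.exp (-a)‖ * arcMean (fun θ => ‖f θ - 0‖) θ₀ t ≤ η * M :=
      (mul_le_mul_of_nonneg_left h5 (norm_nonneg _)).trans (mul_le_mul_of_nonneg_right h4 hM0)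
    linarith

end BarrierSeq

/-- Every bounded measurable function on the circle has barriers which are large in mean on the
short arcs where the function is far in mean from constants. -/
lemma exists_barrierSeq {f : ℝ → ℂ} {M : ℝ} (hf : Measurable f)
    (hper : ∀ θ, f (θ + 2 * Real.pi) = f θ) (hM : ∀ θ, ‖f θ‖ ≤ M) :
    ∃ H : ℕ → ℂ → ℂ, BarrierSeq H ∧ ∀ ε > 0, ∀ A : ℝ, ∃ δ > 0, ∀ θ₀ t : ℝ, 0 < t → t < δ →
      (∃ w : ℂ, arcMean (fun θ => ‖f θ - w‖) θ₀ t ≤ ε) ∨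
        ∃ n, A ≤ arcMean (fun θ => (H n (circlePt θ)).re) θ₀ t := by
  have hM0 : 0 ≤ M := (norm_nonneg _).trans (hM 0)
  have hp : ∀ n : ℕ, (0 : ℝ) < (1 / 2) ^ n := fun n => by positivity
  choose g K δ hK hδ hδn hg hgp hgM hfg hN hgδ using fun n : ℕ =>
    exists_approx_stage hf hper hM (N := n) (hp n) (hp n) (hp n) (show 0 < 3 * M + 1 by positivity)
  choose H hreg him hre0 hre himle hbar using fun n : ℕ =>
    exists_barrier hf hper hM (hg n) (hgp n) (hgM n) (hp n) (hp n) (hK n) (hδ (n + 1)) rfl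
      (hfg n) (hN n)
  refine ⟨H, ⟨hreg, him, hre0, hre, himle⟩, fun ε hε A => ?_⟩
  obtain ⟨k, hk⟩ := exists_pow_lt_of_lt_one (half_pos hε) (show (1 / 2 : ℝ) < 1 by norm_num)
  obtain ⟨l, hl⟩ := exists_nat_ge A
  refine ⟨δ (max k l), hδ _, fun θ₀ t ht htδ => ?_⟩
  have hex : ∃ j, δ (max k l + j + 1) ≤ t := by
    obtain ⟨j, hj⟩ := exists_pow_lt_of_lt_one ht (show (1 / 2 : ℝ) < 1 by norm_num)
    exact ⟨j, ((hδn _).trans (pow_le_pow_of_le_one (by norm_num) (by norm_num)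
      (by omega))).trans hj.le⟩
  classical
  have hspec := Nat.find_spec hex
  have hlt : t < δ (max k l + Nat.find hex) := by
    rcases Nat.eq_zero_or_eq_succ_pred (Nat.find hex) with h | h
    · rwa [h, add_zero]
    · have := Nat.find_min hex (m := (Nat.find hex).pred) (by omega)
      rw [h, Nat.succ_eq_add_one, ← add_assoc]
      exact not_le.1 this
  set n := max k l + Nat.find hex with hn
  have hkn : k ≤ n := (le_max_left k l).trans (Nat.le_add_right _ _)
  have hln : l ≤ n := (le_max_right k l).trans (Nat.le_add_right _ _)
  have hεn : (1 / 2 : ℝ) ^ n ≤ ε / 2 :=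
    (pow_le_pow_of_le_one (by norm_num) (by norm_num) hkn).trans hk.le
  have ht1 : t ≤ 1 := (hlt.le.trans (hδn n)).trans (pow_le_one₀ (by norm_num) (by norm_num))
  by_cases hcase : (1 / 2 : ℝ) ^ n < arcMean (fun θ => ‖f θ - g n θ‖) θ₀ t
  · have : (l : ℝ) ≤ n := by exact_mod_cast hln
    exact Or.inr ⟨n, (hl.trans this).trans (hbar n θ₀ t hspec ht1 hcase)⟩
  · refine Or.inl ⟨g n θ₀, ?_⟩
    have hfi := integrableOn_of_bound hf.aestronglyMeasurable hM
      (volume_arc_ne_top (θ₀ - Real.pi * t) (θ₀ + Real.pi * t))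
    have hfg := (hfi.sub ((hg n).integrableOn_arc _ _)).norm
    have h1 := arcMean_mono (u := fun θ => ‖f θ - g n θ₀‖)
      (v := fun θ => ‖f θ - g n θ‖ + (1 / 2 : ℝ) ^ n) ht
      (hfi.sub (integrableOn_const_arc _ _ _)).norm
      (hfg.add (integrableOn_const_arc _ _ _)) fun θ hθ => by
        have h2 := hgδ n θ θ₀ ((abs_sub_lt_of_mem_arc hθ).trans
          (mul_lt_mul_of_pos_left hlt Real.pi_pos))
        exact (norm_sub_le_norm_sub_add_norm_sub (f θ) (g n θ) (g n θ₀)).trans (by linarith)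
    rw [arcMean_add (by exact hfg) (integrableOn_const_arc _ _ _), arcMean_const _ _ ht] at h1
    linarith

/-- Wolff's theorem: for any bounded measurable function `f` on the unit circle there
is an outer function `E ∈ QA` such that `Ef ∈ VMO`. -/
theorem stmt_2 (f : ℝ → ℂ) (hmeas : Measurable f)
    (hper : ∀ θ : ℝ, f (θ + 2 * Real.pi) = f θ)
    (hbd : ∃ M : ℝ, ∀ θ : ℝ, ‖f θ‖ ≤ M) :
    ∃ (E : ℂ → ℂ) (Eb : ℝ → ℂ), IsOuter E ∧ MemQA E Eb ∧
      IsVMO (fun θ => Eb θ * f θ) := by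
  obtain ⟨M, hM⟩ := hbd
  obtain ⟨H, hH, halt⟩ := exists_barrierSeq hmeas hper hM
  exact ⟨outerExp H, expBoundary H, hH.isOuter,
    ⟨hH.memHinf, hH.hasRadialLimits, hH.isVMO_expBoundary⟩,
    hH.isVMO_expBoundary_mul hmeas hper hM halt⟩

end
end

section
/- Let μ be a finite positive Borel measure on 𝔻 and let {ε_n}_{n≥0} be a decreasing sequence of positive numbers tending to zero. Then there exist an increasing sequence {r_n}_{n≥0} with 0 ≤ r_n < 1, each of the form r_n = 1 − 2^{−N(n)} for some nonnegative integer N(n), with Σ_n (1 − r_n) < ∞, and two positive Borel measures μ₁, μ₂ with μ = μ₁ + μ₂ such that for all n ≥ 0: μ₁({z ∈ 𝔻 : |z| > r_{2n+1}}) ≤ ε_{2n+1}(1 − r_{2n+1}) and μ₂({z ∈ 𝔻 : |z| > r_{2n}}) ≤ ε_{2n}(1 − r_{2n}). -/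
open MeasureTheory Filter Set Topology

noncomputable section

/-- The outer annuli `1 - 2⁻ᴹ < ‖z‖ < 1` eventually have arbitrarily small measure. -/
lemma exists_annulus_measure_le (μ : Measure ℂ) [IsFiniteMeasure μ] (k : ℕ) {c : ℝ} (hc : 0 < c) :
    ∃ M : ℕ, k < M ∧
      μ {z : ℂ | z ∈ unitDisc ∧ 1 - (2 : ℝ) ^ (-(M : ℤ)) < ‖z‖} ≤ ENNReal.ofReal c := by
  have hpow : ∀ M : ℕ, (2 : ℝ) ^ (-(M : ℤ)) = (1 / 2 : ℝ) ^ M := fun M => by simp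
  simp only [hpow]
  set s : ℕ → Set ℂ := fun M => {z : ℂ | z ∈ unitDisc ∧ 1 - (1 / 2 : ℝ) ^ M < ‖z‖}
  have hmeas : ∀ M, NullMeasurableSet (s M) μ := fun M =>
    ((measurableSet_lt measurable_norm measurable_const).inter
      (measurableSet_lt measurable_const measurable_norm)).nullMeasurableSet
  have hanti : Antitone s := by
    rintro a b hab z ⟨hz, hlt⟩
    refine ⟨hz, ?_⟩
    have := pow_le_pow_of_le_one (by norm_num : (0 : ℝ) ≤ 1 / 2) (by norm_num) hab
    linarith
  have hempty : ⋂ M, s M = ∅ := by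
    refine Set.eq_empty_of_forall_notMem fun z hz => ?_
    have hz' : ∀ M, z ∈ s M := Set.mem_iInter.1 hz
    have h1 : ‖z‖ < 1 := (hz' 0).1
    obtain ⟨M, hM⟩ := exists_pow_lt_of_lt_one (sub_pos.2 h1) (by norm_num : (1 / 2 : ℝ) < 1)
    have := (hz' M).2
    linarith
  have htend := tendsto_measure_iInter_atTop hmeas hanti ⟨0, measure_ne_top μ _⟩
  rw [hempty, measure_empty] at htend
  have hev := htend.eventually_lt_const (ENNReal.ofReal_pos.2 hc)
  obtain ⟨M, hM, hkM⟩ := (hev.and (eventually_gt_atTop k)).exists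
  exact ⟨M, hkM, hM.le⟩

/-- Lemma 2.1: decomposition of a finite measure on the disc into two pieces with
small mass on alternating annuli. -/
theorem stmt_5 (μ : Measure ℂ) [IsFiniteMeasure μ] (hsupp : μ unitDiscᶜ = 0)
    (ε : ℕ → ℝ) (hpos : ∀ n, 0 < ε n) (hdec : Antitone ε)
    (hlim : Tendsto ε atTop (nhds 0)) :
    ∃ (r : ℕ → ℝ) (N : ℕ → ℕ) (μ₁ μ₂ : Measure ℂ),
      StrictMono r ∧ (∀ n, 0 ≤ r n ∧ r n < 1) ∧
      (∀ n, r n = 1 - (2 : ℝ) ^ (-(N n : ℤ))) ∧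
      Summable (fun n => 1 - r n) ∧
      μ = μ₁ + μ₂ ∧
      (∀ n : ℕ, μ₁ {z : ℂ | z ∈ unitDisc ∧ r (2 * n + 1) < ‖z‖} ≤
        ENNReal.ofReal (ε (2 * n + 1) * (1 - r (2 * n + 1)))) ∧
      (∀ n : ℕ, μ₂ {z : ℂ | z ∈ unitDisc ∧ r (2 * n) < ‖z‖} ≤
        ENNReal.ofReal (ε (2 * n) * (1 - r (2 * n)))) := by
  choose g hg_lt hg_le using fun (n k : ℕ) =>
    exists_annulus_measure_le μ k (mul_pos (hpos n) (zpow_pos (two_pos : (0 : ℝ) < 2) (-(k : ℤ))))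
  let N : ℕ → ℕ := fun n => Nat.rec (motive := fun _ => ℕ) 0 g n
  let r : ℕ → ℝ := fun n => 1 - (2 : ℝ) ^ (-(N n : ℤ))
  have hN : StrictMono N := strictMono_nat_of_lt_succ fun n => hg_lt n (N n)
  have hr : StrictMono r := fun a b hab => by
    have : (2 : ℝ) ^ (-(N b : ℤ)) < (2 : ℝ) ^ (-(N a : ℤ)) :=
      zpow_lt_zpow_right₀ one_lt_two (by have := hN hab; omega)
    exact sub_lt_sub_left this 1
  have hsmall : ∀ n, μ {z : ℂ | z ∈ unitDisc ∧ r (n + 1) < ‖z‖} ≤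
      ENNReal.ofReal (ε n * (1 - r n)) := fun n => by
    rw [show 1 - r n = (2 : ℝ) ^ (-(N n : ℤ)) from sub_sub_cancel _ _]
    exact hg_le n _
  let A : Set ℂ := ⋃ n : ℕ, {z : ℂ | r (2 * n) < ‖z‖ ∧ ‖z‖ ≤ r (2 * n + 1)}
  have hA : MeasurableSet A := MeasurableSet.iUnion fun n =>
    (measurableSet_lt measurable_const measurable_norm).inter
      (measurableSet_le measurable_norm measurable_const)
  refine ⟨r, N, μ.restrict A, μ.restrict Aᶜ, hr, fun n => ⟨?_, ?_⟩, fun n => rfl, ?_,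
    (Measure.restrict_add_restrict_compl hA).symm, fun n => ?_, fun n => ?_⟩
  · exact sub_nonneg.2 (zpow_le_one_of_nonpos₀ one_le_two (by omega))
  · exact sub_lt_self _ (by positivity)
  · refine Summable.of_nonneg_of_le (fun n => ?_) (fun n => ?_) summable_geometric_two
    · rw [show 1 - r n = (2 : ℝ) ^ (-(N n : ℤ)) from sub_sub_cancel _ _]
      positivity
    · rw [show 1 - r n = (2 : ℝ) ^ (-(N n : ℤ)) from sub_sub_cancel _ _,
        show (1 / 2 : ℝ) ^ n = (2 : ℝ) ^ (-(n : ℤ)) by simp]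
      exact zpow_le_zpow_right₀ one_le_two (by have := hN.le_apply (x := n); omega)
  · rw [Measure.restrict_apply' hA]
    refine (measure_mono ?_).trans (hsmall (2 * n + 1))
    rintro z ⟨⟨hz, hlt⟩, hzA⟩
    obtain ⟨m, hm, hm'⟩ := Set.mem_iUnion.1 hzA
    have hnm : 2 * n + 1 < 2 * m + 1 := hr.lt_iff_lt.1 (hlt.trans_le hm')
    exact ⟨hz, (hr.monotone (by omega : 2 * n + 1 + 1 ≤ 2 * m)).trans_lt hm⟩
  · rw [Measure.restrict_apply' hA.compl]
    refine (measure_mono ?_).trans (hsmall (2 * n))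
    rintro z ⟨⟨hz, hlt⟩, hzA⟩
    exact ⟨hz, not_le.1 fun hle => hzA (Set.mem_iUnion.2 ⟨n, hlt, hle⟩)⟩
end
end
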